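/- (Corollary, Blackwell with noisy feedback) Fix p ∈ (0,1/2) and consider the noisy Blackwell DMBC with noisy feedback Ỹ = (Y₁⊕W₁, Y₂⊕W₂), where (W₁,W₂) are binary random variables with marginals W_i ~ Bern(q_i), drawn independently of (X,Y₁,Y₂) and i.i.d. across channel uses. Then there exists q̄ > 0 such that for every joint law of (W₁,W₂) with max{q₁,q₂} ≤ q̄, the noisy-feedback capacity region strictly contains the no-feedback capacity region: C_NoFB ⊊ C_NoisyFB. -/

import Mathlib

open scoped BigOperators Classical

noncomputable section

namespace BCFB

variable {Ω A B C : Type*}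

/-- Probability of an event under a weight function on a finite sample space. -/
def prOf [Fintype Ω] (w : Ω → ℝ) (E : Ω → Prop) : ℝ :=
  ∑ ω, if E ω then w ω else 0

/-- Distribution (pushforward) of a random variable. -/
def distOf [Fintype Ω] (w : Ω → ℝ) (X : Ω → A) : A → ℝ :=
  fun a => prOf w fun ω => X ω = a

/-- Shannon entropy (base 2) of a random variable. -/
def entOf [Fintype Ω] [Fintype A] (w : Ω → ℝ) (X : Ω → A) : ℝ :=
  -∑ a, distOf w X a * Real.logb 2 (distOf w X a)

/-- Mutual information (base 2). -/
def miOf [Fintype Ω] [Fintype A] [Fintype B] (w : Ω → ℝ) (X : Ω → A) (Y : Ω → B) : ℝ :=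
  entOf w X + entOf w Y - entOf w fun ω => (X ω, Y ω)

/-- Conditional mutual information I(X;Y|Z) (base 2). -/
def cmiOf [Fintype Ω] [Fintype A] [Fintype B] [Fintype C]
    (w : Ω → ℝ) (X : Ω → A) (Y : Ω → B) (Z : Ω → C) : ℝ :=
  entOf w (fun ω => (X ω, Z ω)) + entOf w (fun ω => (Y ω, Z ω))
    - entOf w (fun ω => (X ω, Y ω, Z ω)) - entOf w Z

/-- `w` is a probability mass function. -/
def IsPMF [Fintype Ω] (w : Ω → ℝ) : Prop := (∀ ω, 0 ≤ w ω) ∧ ∑ ω, w ω = 1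

/-- `k` is a transition kernel (each row a pmf). -/
def IsKernel {A B : Type*} [Fintype A] [Fintype B] (k : A → B → ℝ) : Prop :=
  ∀ a, IsPMF (k a)

/-- `X — Y — Z` forms a Markov chain (i.e. `X` and `Z` are conditionally
independent given `Y`). -/
def MarkovChain [Fintype Ω] (w : Ω → ℝ) (X : Ω → A) (Y : Ω → B) (Z : Ω → C) : Prop :=
  ∀ a b c,
    distOf w (fun ω => (X ω, Y ω, Z ω)) (a, b, c) * distOf w Y b
      = distOf w (fun ω => (X ω, Y ω)) (a, b) * distOf w (fun ω => (Z ω, Y ω)) (c, b)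

/-- `X` and `Y` are independent. -/
def IndepRV [Fintype Ω] (w : Ω → ℝ) (X : Ω → A) (Y : Ω → B) : Prop :=
  ∀ a b, distOf w (fun ω => (X ω, Y ω)) (a, b) = distOf w X a * distOf w Y b

/-- Number of messages of rate `R` and blocklength `n`: `⌊2^{nR}⌋`. -/
def msgCard (n : ℕ) (R : ℝ) : ℕ := ⌊(2 : ℝ) ^ ((n : ℝ) * R)⌋₊

/-- Binary entropy function. -/
def hb (u : ℝ) : ℝ := -(u * Real.logb 2 u) - (1 - u) * Real.logb 2 (1 - u)

/-- Empirical frequency of the letter `a` in the sequence `x`. -/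
def freqOf {A : Type*} {n : ℕ} (x : Fin n → A) (a : A) : ℝ :=
  ((Finset.univ.filter fun t => x t = a).card : ℝ) / n

/-- `ε`-typicality of a sequence w.r.t. a pmf `P`. -/
def Typical {A : Type*} (ε : ℝ) {n : ℕ} (P : A → ℝ) (x : Fin n → A) : Prop :=
  ∀ a, |freqOf x a - P a| ≤ ε * P a

section NoFB

variable {X Y1 Y2 : Type*} [Fintype X] [Fintype Y1] [Fintype Y2]

/-- Error probability of a blocklength-`n` no-feedback code over the DMBC `W`. -/
def errProbNoFB (W : X → Y1 × Y2 → ℝ) (n : ℕ) (R0 R1 R2 : ℝ)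
    (enc : Fin (msgCard n R0) × Fin (msgCard n R1) × Fin (msgCard n R2) → Fin n → X)
    (dec1 : (Fin n → Y1) → Fin (msgCard n R0) × Fin (msgCard n R1))
    (dec2 : (Fin n → Y2) → Fin (msgCard n R0) × Fin (msgCard n R2)) : ℝ :=
  (1 / ((msgCard n R0 : ℝ) * (msgCard n R1 : ℝ) * (msgCard n R2 : ℝ))) *
    ∑ m : Fin (msgCard n R0) × Fin (msgCard n R1) × Fin (msgCard n R2),
      ∑ y : Fin n → Y1 × Y2,
        (∏ t, W (enc m t) (y t)) *
          (if dec1 (fun t => (y t).1) ≠ (m.1, m.2.1) ∨ dec2 (fun t => (y t).2) ≠ (m.1, m.2.2)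
            then 1 else 0)

/-- Achievability of a rate triple over the DMBC `W` without feedback. -/
def AchievableNoFB (W : X → Y1 × Y2 → ℝ) (R0 R1 R2 : ℝ) : Prop :=
  0 ≤ R0 ∧ 0 ≤ R1 ∧ 0 ≤ R2 ∧
    ∃ enc : (n : ℕ) →
        Fin (msgCard n R0) × Fin (msgCard n R1) × Fin (msgCard n R2) → Fin n → X,
    ∃ dec1 : (n : ℕ) → (Fin n → Y1) → Fin (msgCard n R0) × Fin (msgCard n R1),
    ∃ dec2 : (n : ℕ) → (Fin n → Y2) → Fin (msgCard n R0) × Fin (msgCard n R2),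
      Filter.Tendsto (fun n => errProbNoFB W n R0 R1 R2 (enc n) (dec1 n) (dec2 n))
        Filter.atTop (nhds 0)

/-- The no-feedback capacity region. -/
def CNoFB (W : X → Y1 × Y2 → ℝ) : Set (ℝ × ℝ × ℝ) :=
  closure {r | AchievableNoFB W r.1 r.2.1 r.2.2}

end NoFB

section FB

variable {X Y1 Y2 Yt : Type*} [Fintype X] [Fintype Y1] [Fintype Y2] [Fintype Yt]

/-- Causality: the time-`t` channel input depends only on feedback symbols before time `t`. -/
def Causal {X Yt : Type*} (n : ℕ) {M : Type*} (enc : Fin n → M → (Fin n → Yt) → X) : Prop :=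
  ∀ (t : Fin n) (m : M) (fb fb' : Fin n → Yt),
    (∀ s : Fin n, (s : ℕ) < (t : ℕ) → fb s = fb' s) → enc t m fb = enc t m fb'

/-- Error probability of a blocklength-`n` feedback code over the DMBC with
generalized feedback `W`. -/
def errProbFB (W : X → Y1 × Y2 × Yt → ℝ) (n : ℕ) (R0 R1 R2 : ℝ)
    (enc : Fin n → Fin (msgCard n R0) × Fin (msgCard n R1) × Fin (msgCard n R2) →
      (Fin n → Yt) → X)
    (dec1 : (Fin n → Y1) → Fin (msgCard n R0) × Fin (msgCard n R1))
    (dec2 : (Fin n → Y2) → Fin (msgCard n R0) × Fin (msgCard n R2)) : ℝ :=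
  (1 / ((msgCard n R0 : ℝ) * (msgCard n R1 : ℝ) * (msgCard n R2 : ℝ))) *
    ∑ m : Fin (msgCard n R0) × Fin (msgCard n R1) × Fin (msgCard n R2),
      ∑ y : Fin n → Y1 × Y2 × Yt,
        (∏ t, W (enc t m fun s => (y s).2.2) (y t)) *
          (if dec1 (fun t => (y t).1) ≠ (m.1, m.2.1) ∨
              dec2 (fun t => (y t).2.1) ≠ (m.1, m.2.2)
            then 1 else 0)

/-- Achievability of a rate triple over the DMBC with generalized feedback `W`. -/
def AchievableFB (W : X → Y1 × Y2 × Yt → ℝ) (R0 R1 R2 : ℝ) : Prop :=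
  0 ≤ R0 ∧ 0 ≤ R1 ∧ 0 ≤ R2 ∧
    ∃ enc : (n : ℕ) → Fin n →
        Fin (msgCard n R0) × Fin (msgCard n R1) × Fin (msgCard n R2) → (Fin n → Yt) → X,
    ∃ dec1 : (n : ℕ) → (Fin n → Y1) → Fin (msgCard n R0) × Fin (msgCard n R1),
    ∃ dec2 : (n : ℕ) → (Fin n → Y2) → Fin (msgCard n R0) × Fin (msgCard n R2),
      (∀ n, Causal n (enc n)) ∧
      Filter.Tendsto (fun n => errProbFB W n R0 R1 R2 (enc n) (dec1 n) (dec2 n))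
        Filter.atTop (nhds 0)

/-- Capacity region of the DMBC with generalized feedback `W`. -/
def CGenFB (W : X → Y1 × Y2 × Yt → ℝ) : Set (ℝ × ℝ × ℝ) :=
  closure {r | AchievableFB W r.1 r.2.1 r.2.2}

end FB

/-- Extension of a DMBC to a generalized-feedback channel with noiseless feedback
`Ỹ = (Y₁, Y₂)`. -/
def noiselessExt {X Y1 Y2 : Type*} (W : X → Y1 × Y2 → ℝ) :
    X → Y1 × Y2 × (Y1 × Y2) → ℝ :=
  fun x y => if y.2.2 = (y.1, y.2.1) then W x (y.1, y.2.1) else 0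

/-- Capacity region of a DMBC with noiseless feedback. -/
def CNoiselessFB {X Y1 Y2 : Type*} [Fintype X] [Fintype Y1] [Fintype Y2]
    (W : X → Y1 × Y2 → ℝ) : Set (ℝ × ℝ × ℝ) :=
  CGenFB (noiselessExt W)

section Marton

variable {X Y1 Y2 : Type*} [Fintype X] [Fintype Y1] [Fintype Y2]

/-- The single-letter Marton constraints for the rate triple `(R0,R1,R2)`. -/
def MartonCond (W : X → Y1 × Y2 → ℝ) (R0 R1 R2 : ℝ) : Prop :=
  ∃ (k0 k1 k2 : ℕ) (p : Fin k0 × Fin k1 × Fin k2 → ℝ)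
    (f : Fin k0 × Fin k1 × Fin k2 → X), IsPMF p ∧
    (let w : (Fin k0 × Fin k1 × Fin k2) × Y1 × Y2 → ℝ := fun z => p z.1 * W (f z.1) z.2
     let U0 := fun z : (Fin k0 × Fin k1 × Fin k2) × Y1 × Y2 => z.1.1
     let U1 := fun z : (Fin k0 × Fin k1 × Fin k2) × Y1 × Y2 => z.1.2.1
     let U2 := fun z : (Fin k0 × Fin k1 × Fin k2) × Y1 × Y2 => z.1.2.2
     let Yr1 := fun z : (Fin k0 × Fin k1 × Fin k2) × Y1 × Y2 => z.2.1
     let Yr2 := fun z : (Fin k0 × Fin k1 × Fin k2) × Y1 × Y2 => z.2.2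
     R0 < min (miOf w U0 Yr1) (miOf w U0 Yr2) ∧
     R0 + R1 < miOf w (fun z => (U0 z, U1 z)) Yr1 ∧
     R0 + R2 < miOf w (fun z => (U0 z, U2 z)) Yr2 ∧
     R0 + R1 + R2 < cmiOf w U1 Yr1 U0 + cmiOf w U2 Yr2 U0
       + min (miOf w U0 Yr1) (miOf w U0 Yr2) - cmiOf w U1 U2 U0)

/-- Marton's achievable region for the DMBC `W` without feedback. -/
def MartonRegion (W : X → Y1 × Y2 → ℝ) : Set (ℝ × ℝ × ℝ) :=
  closure {r | 0 ≤ r.1 ∧ 0 ≤ r.2.1 ∧ 0 ≤ r.2.2 ∧ MartonCond W r.1 r.2.1 r.2.2}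

end Marton

end BCFB
namespace BCFB

/-- The noisy Blackwell DMBC with noise parameter `p`: with `Z ~ Bern(p)`,
`Y₁ = Z ⊕ 1{X ≥ 1}` and `Y₂ = Z ⊕ 1{X = 2}`. -/
def blackwellW (p : ℝ) : Fin 3 → Bool × Bool → ℝ :=
  fun x y => ∑ z : Bool,
    (if z then p else 1 - p) *
      (if y = (Bool.xor (decide (1 ≤ (x : ℕ))) z, Bool.xor (decide ((x : ℕ) = 2)) z)
        then 1 else 0)

/-- The noisy Blackwell DMBC with noisy feedback `Ỹ = (Y₁⊕W₁, Y₂⊕W₂)`, where the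
feedback-noise pair `(W₁,W₂)` has law `Q`. -/
def blackwellNoisyW (p : ℝ) (Q : Bool × Bool → ℝ) :
    Fin 3 → Bool × Bool × (Bool × Bool) → ℝ :=
  fun x y =>
    blackwellW p x (y.1, y.2.1) * Q (Bool.xor y.2.2.1 y.1, Bool.xor y.2.2.2 y.2.1)

end BCFB
namespace BCFB

/-- The probability that a `Bern(β)` bit passed through a `BSC(p)` equals one. -/
def bconv (p β : ℝ) : ℝ := p + (1 - 2 * p) * β

/-- The gap (in nats) between the information through a `BSC(p)` with input `Bern(β)` and
the information through the erasure channel with the same capacity. -/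
def bscGap (p β : ℝ) : ℝ :=
  Real.binEntropy (bconv p β) - Real.binEntropy p
    - (1 - Real.binEntropy p / Real.log 2) * Real.binEntropy β

lemma bscGap_one_sub (p β : ℝ) : bscGap p (1 - β) = bscGap p β := by
  have h : bconv p (1 - β) = 1 - bconv p β := by simp only [bconv]; ring
  simp only [bscGap, h, Real.binEntropy_one_sub]

lemma bscGap_zero (p : ℝ) : bscGap p 0 = 0 := by simp [bscGap, bconv]

lemma bscGap_half (p : ℝ) : bscGap p 2⁻¹ = 0 := by
  have h : bconv p 2⁻¹ = 2⁻¹ := by simp only [bconv]; ring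
  have h2 : Real.log 2 ≠ 0 := (Real.log_pos (by norm_num)).ne'
  simp only [bscGap, h, Real.binEntropy_two_inv]
  field_simp
  ring

lemma continuous_bscGap (p : ℝ) : Continuous (bscGap p) := by
  unfold bscGap bconv
  fun_prop

lemma binEntropy_lt_log_two_of {p : ℝ} (hp : p < 1 / 2) : Real.binEntropy p < Real.log 2 := by
  rw [Real.binEntropy_lt_log_two]
  intro h
  rw [h] at hp
  norm_num at hp

lemma bconv_mem {p β : ℝ} (hp : p < 1 / 2) (h0 : 0 ≤ β) (h1 : β ≤ 1) :
    p ≤ bconv p β ∧ bconv p β ≤ 1 - p := by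
  simp only [bconv]
  constructor <;> nlinarith

lemma deriv2_bscGap {p β : ℝ} (hp0 : 0 < p) (hp : p < 1 / 2) (h0 : 0 < β) (h1 : β < 1) :
    deriv^[2] (bscGap p) β =
      ((1 - Real.binEntropy p / Real.log 2) * (p * (1 - p))
        - (Real.binEntropy p / Real.log 2) * (1 - 2 * p) ^ 2 * (β * (1 - β)))
      / (bconv p β * (1 - bconv p β) * (β * (1 - β))) := by
  set C := 1 - Real.binEntropy p / Real.log 2 with hC
  have hlin : ∀ x : ℝ, HasDerivAt (bconv p) (1 - 2 * p) x := fun x => by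
    have := ((hasDerivAt_id x).const_mul (1 - 2 * p)).const_add p
    rwa [mul_one] at this
  have hd : ∀ x ∈ Set.Ioo (0 : ℝ) 1, HasDerivAt (bscGap p)
      ((Real.log (1 - bconv p x) - Real.log (bconv p x)) * (1 - 2 * p)
        - C * (Real.log (1 - x) - Real.log x)) x := by
    intro x hx
    obtain ⟨ha, hb⟩ := bconv_mem hp hx.1.le hx.2.le
    have e1 := (Real.hasDerivAt_binEntropy (p := bconv p x) (by linarith) (by linarith)).comp x
      (hlin x)
    have e2 := (Real.hasDerivAt_binEntropy (p := x) hx.1.ne' hx.2.ne).const_mul C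
    exact (e1.sub_const (Real.binEntropy p)).sub e2
  have hev : deriv (bscGap p) =ᶠ[nhds β] fun x =>
      (Real.log (1 - bconv p x) - Real.log (bconv p x)) * (1 - 2 * p)
        - C * (Real.log (1 - x) - Real.log x) := by
    filter_upwards [isOpen_Ioo.mem_nhds (show β ∈ Set.Ioo (0 : ℝ) 1 from ⟨h0, h1⟩)] with x hx
    exact (hd x hx).deriv
  obtain ⟨ha, hb⟩ := bconv_mem hp h0.le h1.le
  have hy0 : bconv p β ≠ 0 := by linarith
  have hy1 : 1 - bconv p β ≠ 0 := by linarith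
  have hb0 : β ≠ 0 := h0.ne'
  have hb1 : 1 - β ≠ 0 := by linarith
  have e1 := (((hlin β).const_sub 1).log hy1).sub ((hlin β).log hy0)
  have e2 := (((hasDerivAt_id β).const_sub 1).log hb1).sub ((hasDerivAt_id β).log hb0)
  have e := (e1.mul_const (1 - 2 * p)).sub (e2.const_mul C)
  have hq : bconv p β * (1 - bconv p β) = p * (1 - p) + (1 - 2 * p) ^ 2 * (β * (1 - β)) := by
    simp only [bconv]; ring
  have hfin : deriv (deriv (bscGap p)) β = _ := hev.deriv_eq.trans e.deriv
  rw [Function.iterate_succ, Function.iterate_one, Function.comp_apply, hfin]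
  have hh : Real.binEntropy p / Real.log 2 = 1 - C := by rw [hC]; ring
  rw [hh]
  simp only [id]
  have key : C * (p * (1 - p)) - (1 - C) * (1 - 2 * p) ^ 2 * (β * (1 - β))
      = C * (bconv p β * (1 - bconv p β)) - (1 - 2 * p) ^ 2 * (β * (1 - β)) := by
    rw [hq]; ring
  rw [key]
  field_simp
  ring

/-- A `BEC` with the capacity of a `BSC` is strictly more capable than the `BSC`. -/
lemma bscGap_neg {p β : ℝ} (hp0 : 0 < p) (hp : p < 1 / 2) (h0 : 0 < β) (h1 : β < 1)
    (hne : β ≠ 2⁻¹) : bscGap p β < 0 := by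
  wlog hlt : β < 2⁻¹ generalizing β
  · rw [← bscGap_one_sub]
    refine this (by linarith) (by linarith) (fun h => hne ?_) ?_
    · linarith
    · have : 2⁻¹ < β := lt_of_le_of_ne (not_lt.1 hlt) (Ne.symm hne)
      linarith
  have hl2 : 0 < Real.log 2 := Real.log_pos (by norm_num)
  have hh := binEntropy_lt_log_two_of hp
  have hh0 : 0 < Real.binEntropy p := Real.binEntropy_pos hp0 (by linarith)
  set a := (1 - Real.binEntropy p / Real.log 2) * (p * (1 - p)) with ha
  set d := (Real.binEntropy p / Real.log 2) * (1 - 2 * p) ^ 2 with hd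
  have hd0 : 0 < d := by
    have : 0 < 1 - 2 * p := by linarith
    positivity
  have ha0 : 0 < a := by
    have : Real.binEntropy p / Real.log 2 < 1 := (div_lt_one hl2).2 hh
    have h1p : 0 < 1 - p := by linarith
    have : 0 < 1 - Real.binEntropy p / Real.log 2 := by linarith
    positivity
  have hden : ∀ x, 0 < x → x < 1 → 0 < bconv p x * (1 - bconv p x) * (x * (1 - x)) := by
    intro x hx0 hx1
    obtain ⟨hA, hB⟩ := bconv_mem hp hx0.le hx1.le
    have i1 : 0 < bconv p x := by linarith
    have i2 : 0 < 1 - bconv p x := by linarith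
    have i3 : 0 < 1 - x := by linarith
    positivity
  have hconvex : ∀ b, 0 < b → b ≤ 2⁻¹ → d * (b * (1 - b)) ≤ a →
      StrictConvexOn ℝ (Set.Icc 0 b) (bscGap p) := by
    intro b hb0 hb hle
    refine strictConvexOn_of_deriv2_pos (convex_Icc _ _) (continuous_bscGap p).continuousOn ?_
    intro x hx
    rw [interior_Icc] at hx
    have hx1 : x < 1 := by linarith [hx.2]
    rw [deriv2_bscGap hp0 hp hx.1 hx1]
    refine div_pos ?_ (hden x hx.1 hx1)
    have : x * (1 - x) < b * (1 - b) := by nlinarith [hx.1, hx.2]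
    nlinarith
  have hend : ∀ b, 0 < b → b ≤ 2⁻¹ → d * (b * (1 - b)) ≤ a → bscGap p b ≤ 0 → β < b →
      bscGap p β < 0 := by
    intro b hb0 hb hle hgb hβ
    have hs := (hconvex b hb0 hb hle).2 (Set.left_mem_Icc.2 hb0.le) (Set.right_mem_Icc.2 hb0.le)
      hb0.ne (show 0 < 1 - β / b by rw [sub_pos, div_lt_one hb0]; exact hβ)
      (show 0 < β / b by positivity) (by ring)
    have e : (1 - β / b) • (0 : ℝ) + (β / b) • b = β := by
      simp only [smul_eq_mul]; field_simp; ring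
    rw [e, bscGap_zero] at hs
    simp only [smul_eq_mul, mul_zero, zero_add] at hs
    have : β / b * bscGap p b ≤ 0 := mul_nonpos_of_nonneg_of_nonpos (by positivity) hgb
    linarith
  by_cases hcase : d * (2⁻¹ * (1 - 2⁻¹)) ≤ a
  · exact hend 2⁻¹ (by norm_num) le_rfl hcase (bscGap_half p).le hlt
  push Not at hcase
  have hivt : ∃ b ∈ Set.Icc (0 : ℝ) 2⁻¹, d * (b * (1 - b)) = a := by
    have hc : ContinuousOn (fun b : ℝ => d * (b * (1 - b))) (Set.Icc 0 2⁻¹) := by fun_prop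
    obtain ⟨b, hb, hb'⟩ := intermediate_value_Icc (by norm_num : (0 : ℝ) ≤ 2⁻¹) hc
      (show a ∈ Set.Icc _ _ from ⟨by simpa using ha0.le, hcase.le⟩)
    exact ⟨b, hb, hb'⟩
  obtain ⟨b, hb, hba⟩ := hivt
  have hb0 : 0 < b := by
    rcases hb.1.eq_or_lt with h | h
    · rw [← h] at hba; simp at hba; linarith
    · exact h
  have hb2 : b < 2⁻¹ := by
    rcases hb.2.eq_or_lt with h | h
    · rw [h] at hba; linarith
    · exact h
  have hconc : StrictConcaveOn ℝ (Set.Icc b (1 - b)) (bscGap p) := by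
    refine strictConcaveOn_of_deriv2_neg (convex_Icc _ _) (continuous_bscGap p).continuousOn ?_
    intro x hx
    rw [interior_Icc] at hx
    have hx0 : 0 < x := by linarith [hx.1]
    have hx1 : x < 1 := by linarith [hx.2]
    rw [deriv2_bscGap hp0 hp hx0 hx1]
    refine div_neg_of_neg_of_pos ?_ (hden x hx0 hx1)
    have : b * (1 - b) < x * (1 - x) := by nlinarith [hx.1, hx.2]
    nlinarith
  have hmid : ∀ x, b ≤ x → x < 2⁻¹ → bscGap p x < 0 := by
    intro x hx hx2
    have hs := hconc.2 (show x ∈ Set.Icc b (1 - b) from ⟨hx, by linarith⟩)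
      (show 1 - x ∈ Set.Icc b (1 - b) from ⟨by linarith, by linarith⟩)
      (by intro h; linarith) (show (0 : ℝ) < 2⁻¹ by norm_num) (show (0 : ℝ) < 2⁻¹ by norm_num)
      (by norm_num)
    have e : (2⁻¹ : ℝ) • x + (2⁻¹ : ℝ) • (1 - x) = 2⁻¹ := by simp only [smul_eq_mul]; ring
    rw [e, bscGap_half, bscGap_one_sub, smul_eq_mul] at hs
    linarith
  rcases lt_or_ge β b with h | h
  · exact hend b hb0 hb2.le hba.le (hmid b le_rfl hb2).le h
  · exact hmid β h hlt

lemma binEntropy_add_le_log_three {β : ℝ} (h0 : 0 < β) (h1 : β < 1) :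
    Real.binEntropy β + (1 - β) * Real.log 2 ≤ Real.log 3 := by
  have hb : 0 < 1 - β := by linarith
  have e1 := Real.log_le_sub_one_of_pos (show 0 < 1 / (3 * β) by positivity)
  have e2 := Real.log_le_sub_one_of_pos (show 0 < 2 / (3 * (1 - β)) by positivity)
  rw [Real.log_div one_ne_zero (by positivity), Real.log_mul (by norm_num) h0.ne',
    Real.log_one] at e1
  rw [Real.log_div two_ne_zero (by positivity), Real.log_mul (by norm_num) hb.ne'] at e2
  have f1 := mul_le_mul_of_nonneg_left e1 h0.le
  have f2 := mul_le_mul_of_nonneg_left e2 hb.le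
  have g1 : β * (1 / (3 * β) - 1) = 1 / 3 - β := by field_simp
  have g2 : (1 - β) * (2 / (3 * (1 - β)) - 1) = 2 / 3 - (1 - β) := by field_simp
  rw [g1] at f1
  rw [g2] at f2
  rw [Real.binEntropy, Real.log_inv, Real.log_inv]
  linarith

/-- A dual certificate for the sum rate without feedback. The conditions on `ℓ` say that
`exp (-ℓ)` is a pmf on the output of the second receiver. -/
lemma exists_dual_certificate {p : ℝ} (hp0 : 0 < p) (hp : p < 1 / 2) :
    ∃ (l : Bool → ℝ) (K : ℝ), Real.exp (-l true) + Real.exp (-l false) = 1 ∧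
      Real.log 2 - Real.binEntropy p + (p * l true + (1 - p) * l false) = K ∧
      (1 - p) * l true + p * l false = K ∧
      K - Real.binEntropy p < (1 - Real.binEntropy p / Real.log 2) * Real.log 3 := by
  have hl2 : 0 < Real.log 2 := Real.log_pos (by norm_num)
  have hh := binEntropy_lt_log_two_of hp
  have hε : 0 < 1 - 2 * p := by linarith
  set c := Real.log 2 - Real.binEntropy p with hc
  have hc0 : 0 < c := by linarith
  have hC : 1 - Real.binEntropy p / Real.log 2 = c / Real.log 2 := by
    rw [hc]; field_simp
  set κ := c / (1 - 2 * p) with hκ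
  have hκ0 : 0 < κ := by positivity
  have hκε : κ * (1 - 2 * p) = c := by rw [hκ]; field_simp
  set y := 1 / (1 + Real.exp κ) with hy
  have hy0 : 0 < y := by positivity
  have hy1 : y * (1 + Real.exp κ) = 1 := by rw [hy]; field_simp
  have h1y : 1 - y = y * Real.exp κ := by linarith
  have h1y0 : 0 < 1 - y := by rw [h1y]; positivity
  have hlog : Real.log (1 - y) = Real.log y + κ := by
    rw [h1y, Real.log_mul hy0.ne' (Real.exp_pos _).ne', Real.log_exp]
  have hκle : Real.exp κ ≤ (1 - p) / p := by
    rw [← Real.le_log_iff_exp_le (div_pos (by linarith) hp0),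
      Real.log_div (by linarith) hp0.ne', hκ, div_le_iff₀ hε, hc, Real.binEntropy,
      Real.log_inv, Real.log_inv]
    have hmono : Real.log p ≤ Real.log (1 - p) := Real.log_le_log hp0 (by linarith)
    have hq : Real.log (p * (1 - p)) ≤ Real.log ((1 / 2) ^ 2) :=
      Real.log_le_log (mul_pos hp0 (by linarith)) (by nlinarith [sq_nonneg (1 - 2 * p)])
    rw [Real.log_mul hp0.ne' (by linarith), Real.log_pow, one_div, Real.log_inv] at hq
    push_cast at hq
    nlinarith
  have hyp : p ≤ y := by
    rw [hy, le_div_iff₀ (by positivity)]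
    rw [le_div_iff₀ hp0] at hκle
    linarith
  have hy2 : y ≤ 1 / 2 := by
    have := Real.one_le_exp hκ0.le
    nlinarith
  set β := (y - p) / (1 - 2 * p) with hβ
  have hβy : bconv p β = y := by rw [hβ, bconv, mul_div_cancel₀ _ hε.ne']; ring
  have hβ0 : 0 ≤ β := div_nonneg (by linarith) hε.le
  have hβ1 : β ≤ 2⁻¹ := by
    rw [hβ, div_le_iff₀ hε]
    linarith
  set K := -(1 - p) * Real.log y - p * Real.log (1 - y) with hK
  have hK1 : c - (p * Real.log y + (1 - p) * Real.log (1 - y)) = K := by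
    rw [hK, hlog, ← hκε]; ring
  have hK2 : K = (1 - β) * c + Real.binEntropy (bconv p β) := by
    rw [hβy]
    have : K = (1 - β) * (c - (p * Real.log y + (1 - p) * Real.log (1 - y))) + β * K := by
      rw [hK1]; ring
    rw [this, hK, Real.binEntropy, Real.log_inv, Real.log_inv]
    have hy' : y = p + (1 - 2 * p) * β := hβy.symm
    generalize Real.log y = u at *
    generalize Real.log (1 - y) = v at *
    rw [hy']
    ring
  refine ⟨fun b => if b then -Real.log y else -Real.log (1 - y), K, ?_, ?_, ?_, ?_⟩
  · simp [Real.exp_log hy0, Real.exp_log h1y0]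
  · simp only [if_true, Bool.false_eq_true, if_false]; linarith
  · simp only [if_true, Bool.false_eq_true, if_false]; rw [hK]; ring
  rw [hC]
  have h3 : (3 / 2 : ℝ) * Real.log 2 < Real.log 3 := by
    have : Real.log ((2 : ℝ) ^ 3) < Real.log (3 ^ 2) := Real.log_lt_log (by norm_num) (by norm_num)
    rw [Real.log_pow, Real.log_pow] at this
    push_cast at this
    linarith
  have hcl : 0 < c / Real.log 2 := by positivity
  have hbase : 3 / 2 * c < c / Real.log 2 * Real.log 3 := by
    have := mul_lt_mul_of_pos_left h3 hcl
    have e : c / Real.log 2 * (3 / 2 * Real.log 2) = 3 / 2 * c := by field_simp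
    linarith
  rcases hβ0.eq_or_lt with h | h
  · rw [hK2, ← h]
    simp only [bconv, mul_zero, add_zero]
    linarith
  rcases hβ1.eq_or_lt with h' | h'
  · have := bscGap_half p
    rw [bscGap, hC, Real.binEntropy_two_inv] at this
    have e : c / Real.log 2 * Real.log 2 = c := by field_simp
    rw [e] at this
    rw [hK2, h']
    linarith
  · have hneg := bscGap_neg hp0 hp h (by linarith) h'.ne
    rw [bscGap, hC] at hneg
    have h4 := mul_le_mul_of_nonneg_left
      (binEntropy_add_le_log_three h (by linarith)) hcl.le
    have e : c / Real.log 2 * (Real.binEntropy β + (1 - β) * Real.log 2)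
        = c / Real.log 2 * Real.binEntropy β + (1 - β) * c := by field_simp
    rw [hK2]
    linarith

/-- The pushforward of a product weight along a letterwise map. -/
lemma sum_pi_comp {n : ℕ} {Y U : Type*} [Fintype Y] [Fintype U] (κ : Fin n → Y → ℝ) (π : Y → U)
    (g : (Fin n → U) → ℝ) :
    ∑ y : Fin n → Y, (∏ t, κ t (y t)) * g (fun t => π (y t))
      = ∑ u : Fin n → U, (∏ t, ∑ y, if π y = u t then κ t y else 0) * g u := by
  simp_rw [Finset.prod_univ_sum, Fintype.piFinset_univ, Finset.sum_mul]
  rw [Finset.sum_comm]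
  refine Finset.sum_congr rfl fun y _ => ?_
  rw [Finset.sum_eq_single fun t => π (y t)]
  · simp
  · intro u _ hu
    have : ∃ t, π (y t) ≠ u t := by
      by_contra! h
      exact hu (funext fun t => (h t).symm)
    obtain ⟨t, ht⟩ := this
    rw [Finset.prod_eq_zero (Finset.mem_univ t) (by rw [if_neg ht]), zero_mul]
  · simp

/-- The output measure of a memoryless channel for a weighted family of input words. -/
def outLaw {X J : Type*} [Fintype J] (A : X → Bool → ℝ) (w : J → ℝ) {n : ℕ}
    (x : J → Fin n → X) (y : Fin n → Bool) : ℝ :=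
  ∑ j, w j * ∏ t, A (x j t) (y t)

section OutLaw

variable {X J : Type*} [Fintype J]

lemma outLaw_cons (A : X → Bool → ℝ) (w : J → ℝ) {n : ℕ} (x : J → Fin (n + 1) → X) (b : Bool)
    (y : Fin n → Bool) :
    outLaw A w x (Fin.cons b y : Fin (n + 1) → Bool)
      = outLaw A (fun j => w j * A (x j 0) b) (fun j t => x j t.succ) y := by
  simp [outLaw, Fin.prod_univ_succ, mul_assoc]

lemma sum_prod_kernel {A : X → Bool → ℝ} (hA : ∀ x, ∑ y, A x y = 1) {n : ℕ} (x : Fin n → X) :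
    ∑ y : Fin n → Bool, ∏ t, A (x t) (y t) = 1 := by
  have h := (Finset.prod_univ_sum (fun _ : Fin n => (Finset.univ : Finset Bool))
    fun t y => A (x t) y).symm
  rw [Fintype.piFinset_univ] at h
  rw [h]
  simp only [hA, Finset.prod_const_one]

lemma sum_outLaw {A : X → Bool → ℝ} (hA : ∀ x, ∑ y, A x y = 1) (w : J → ℝ) {n : ℕ}
    (x : J → Fin n → X) : ∑ y, outLaw A w x y = ∑ j, w j := by
  simp only [outLaw]
  rw [Finset.sum_comm]
  refine Finset.sum_congr rfl fun j _ => ?_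
  rw [← Finset.mul_sum, sum_prod_kernel hA, mul_one]

/-- Tensorization of a bound on the difference of the output entropies of two channels. -/
lemma tensorize {A B : X → Bool → ℝ} (hA0 : ∀ x y, 0 ≤ A x y) (hB0 : ∀ x y, 0 ≤ B x y)
    (hA : ∀ x, ∑ y, A x y = 1) (hB : ∀ x, ∑ y, B x y = 1) (l : Bool → ℝ) (K : ℝ)
    (h1 : ∀ (w : J → ℝ) (x : J → X), (∀ j, 0 ≤ w j) →
      ∑ y, (Real.negMulLog (∑ j, w j * A (x j) y) - Real.negMulLog (∑ j, w j * B (x j) y)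
        + (∑ j, w j * B (x j) y) * l y) ≤ K * ∑ j, w j) :
    ∀ (n : ℕ) (w : J → ℝ) (x : J → Fin n → X), (∀ j, 0 ≤ w j) →
      ∑ y, (Real.negMulLog (outLaw A w x y) - Real.negMulLog (outLaw B w x y)
        + outLaw B w x y * ∑ t, l (y t)) ≤ n * K * ∑ j, w j := by
  intro n
  induction n with
  | zero => intro w x _; simp [outLaw]
  | succ n ih =>
    intro w x hw
    rw [← (Fin.consEquiv fun _ : Fin (n + 1) => Bool).sum_comp, Fintype.sum_prod_type]
    have hce : ∀ b (y : Fin n → Bool), (Fin.consEquiv fun _ : Fin (n + 1) => Bool) (b, y)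
        = (Fin.cons b y : Fin (n + 1) → Bool) := fun _ _ => rfl
    simp only [hce, outLaw_cons, Fin.sum_univ_succ, Fin.cons_zero, Fin.cons_succ]
    set x' : J → Fin n → X := fun j t => x j t.succ with hx'
    set hyb : Bool → (Fin n → Bool) → ℝ := fun b y =>
      outLaw A (fun j => w j * B (x j 0) b) x' y with hhyb
    have hfst : ∑ b, ∑ y, (Real.negMulLog (outLaw A (fun j => w j * A (x j 0) b) x' y)
        - Real.negMulLog (hyb b y) + hyb b y * l b) ≤ K * ∑ j, w j := by
      rw [Finset.sum_comm]
      have e : K * ∑ j, w j = ∑ y, K * outLaw A w x' y := by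
        rw [← Finset.mul_sum, sum_outLaw hA]
      rw [e]
      refine Finset.sum_le_sum fun y _ => ?_
      refine le_of_eq_of_le ?_ (h1 (fun j => w j * ∏ t, A (x' j t) (y t)) (fun j => x j 0)
        fun j => mul_nonneg (hw j) (Finset.prod_nonneg fun t _ => hA0 _ _))
      refine Finset.sum_congr rfl fun b _ => ?_
      simp only [hhyb, outLaw, mul_right_comm]
    have hsnd : ∑ b, ∑ y, (Real.negMulLog (hyb b y)
        - Real.negMulLog (outLaw B (fun j => w j * B (x j 0) b) x' y)
        + outLaw B (fun j => w j * B (x j 0) b) x' y * ∑ t, l (y t)) ≤ n * K * ∑ j, w j := by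
      have e : n * K * ∑ j, w j = ∑ b, n * K * ∑ j, w j * B (x j 0) b := by
        rw [← Finset.mul_sum, Finset.sum_comm]
        simp_rw [← Finset.mul_sum, hB, mul_one]
      rw [e]
      exact Finset.sum_le_sum fun b _ => ih _ x' fun j => mul_nonneg (hw j) (hB0 _ _)
    have hlin : ∀ b, ∑ y, outLaw B (fun j => w j * B (x j 0) b) x' y * l b
        = ∑ y, hyb b y * l b := by
      intro b
      rw [← Finset.sum_mul, ← Finset.sum_mul, sum_outLaw hB, sum_outLaw hA]
    have hlin' := Finset.sum_congr rfl fun b (_ : b ∈ (Finset.univ : Finset Bool)) => hlin b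
    simp only [Finset.sum_add_distrib, Finset.sum_sub_distrib, mul_add] at hfst hsnd hlin' ⊢
    push_cast
    linarith

end OutLaw

/-- The binary symmetric channel. -/
def bsc (p : ℝ) (s y : Bool) : ℝ := if s = y then 1 - p else p

/-- The bit seen (through noise) by the first receiver. -/
def bitOne (x : Fin 3) : Bool := decide (1 ≤ (x : ℕ))

/-- The bit seen (through noise) by the second receiver. -/
def bitTwo (x : Fin 3) : Bool := decide ((x : ℕ) = 2)

lemma bsc_pos {p : ℝ} (hp0 : 0 < p) (hp : p < 1 / 2) (s y : Bool) : 0 < bsc p s y := by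
  unfold bsc; split_ifs <;> linarith

lemma sum_bsc (p : ℝ) (s : Bool) : ∑ y, bsc p s y = 1 := by
  cases s <;> simp [bsc]

lemma blackwellW_fst (p : ℝ) (x : Fin 3) (u : Bool) :
    ∑ y : Bool × Bool, (if y.1 = u then blackwellW p x y else 0) = bsc p (bitOne x) u := by
  fin_cases x <;> cases u <;> simp [Fintype.sum_prod_type, blackwellW, bsc, bitOne]

lemma blackwellW_snd (p : ℝ) (x : Fin 3) (u : Bool) :
    ∑ y : Bool × Bool, (if y.2 = u then blackwellW p x y else 0) = bsc p (bitTwo x) u := by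
  fin_cases x <;> cases u <;> simp [Fintype.sum_prod_type, blackwellW, bsc, bitTwo]

lemma blackwellW_nonneg {p : ℝ} (hp0 : 0 < p) (hp : p < 1 / 2) (x : Fin 3) (y : Bool × Bool) :
    0 ≤ blackwellW p x y := by
  unfold blackwellW
  refine Finset.sum_nonneg fun z _ => mul_nonneg ?_ ?_ <;> split_ifs <;> linarith

lemma binEntropy_bconv_ge_chord {p b : ℝ} (hp0 : 0 < p) (hp : p < 1 / 2) (h0 : 0 ≤ b)
    (h2 : b ≤ 1 / 2) :
    (1 - 2 * b) * Real.binEntropy p + 2 * b * Real.log 2 ≤ Real.binEntropy (bconv p b) := by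
  have h := Real.strictConcave_binEntropy.concaveOn.2 (x := p) (y := 2⁻¹)
    ⟨hp0.le, by linarith⟩ ⟨by norm_num, by norm_num⟩ (show 0 ≤ 1 - 2 * b by linarith)
    (show 0 ≤ 2 * b by linarith) (by ring)
  have e : (1 - 2 * b) • p + (2 * b) • (2⁻¹ : ℝ) = bconv p b := by
    simp only [smul_eq_mul, bconv]; ring
  rw [e, Real.binEntropy_two_inv] at h
  simpa using h

lemma normalized_single_letter {p : ℝ} (hp0 : 0 < p) (hp : p < 1 / 2) {l : Bool → ℝ} {K : ℝ}
    (h1 : Real.log 2 - Real.binEntropy p + (p * l true + (1 - p) * l false) = K)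
    (h2 : (1 - p) * l true + p * l false = K) {s b : ℝ} (hb : 0 ≤ b) (hbs : b ≤ s) (hs : s ≤ 1) :
    Real.binEntropy (bconv p s) - Real.binEntropy (bconv p b)
      + (bconv p b * l true + (1 - bconv p b) * l false) ≤ K := by
  have hc := binEntropy_lt_log_two_of hp
  have hlin : bconv p b * l true + (1 - bconv p b) * l false
      = (1 - b) * (K - (Real.log 2 - Real.binEntropy p)) + b * K := by
    have : p * l true + (1 - p) * l false = K - (Real.log 2 - Real.binEntropy p) := by linarith
    rw [← this]
    conv_rhs => rw [← h2]
    simp only [bconv]; ring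
  rw [hlin]
  rcases le_total b (1 / 2) with h | h
  · have e1 := binEntropy_bconv_ge_chord hp0 hp hb h
    have e2 : Real.binEntropy (bconv p s) ≤ Real.log 2 := Real.binEntropy_le_log_two
    nlinarith
  · have hmono : Real.binEntropy (bconv p s) ≤ Real.binEntropy (bconv p b) := by
      refine Real.binEntropy_strictAntiOn.antitoneOn ?_ ?_ ?_ <;>
        simp only [bconv, Set.mem_Icc] <;>
        first
          | nlinarith
          | (constructor <;> nlinarith)
    nlinarith

lemma sum_negMulLog_bool (T a : ℝ) :
    Real.negMulLog (T * a) + Real.negMulLog (T * (1 - a))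
      = T * Real.binEntropy a + Real.negMulLog T := by
  rw [Real.negMulLog_mul, Real.negMulLog_mul,
    Real.binEntropy_eq_negMulLog_add_negMulLog_one_sub]
  ring

lemma single_letter {p : ℝ} (hp0 : 0 < p) (hp : p < 1 / 2) {l : Bool → ℝ} {K : ℝ}
    (h1 : Real.log 2 - Real.binEntropy p + (p * l true + (1 - p) * l false) = K)
    (h2 : (1 - p) * l true + p * l false = K) {J : Type*} [Fintype J] (w : J → ℝ)
    (x : J → Fin 3) (hw : ∀ j, 0 ≤ w j) :
    ∑ y, (Real.negMulLog (∑ j, w j * bsc p (bitOne (x j)) y)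
        - Real.negMulLog (∑ j, w j * bsc p (bitTwo (x j)) y)
        + (∑ j, w j * bsc p (bitTwo (x j)) y) * l y) ≤ K * ∑ j, w j := by
  set T := ∑ j, w j with hT
  rcases (Finset.sum_nonneg fun j _ => hw j : 0 ≤ ∑ j, w j).eq_or_lt with h0 | hpos
  · have hz : ∀ j, w j = 0 := fun j =>
      (Finset.sum_eq_zero_iff_of_nonneg fun j _ => hw j).1 h0.symm j (Finset.mem_univ j)
    simp [hz, hT]
  rw [← hT] at hpos
  have hgen : ∀ f : Fin 3 → Bool, ∃ a, a = (∑ j, if f (x j) then w j else 0) / T ∧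
      ∑ j, w j * bsc p (f (x j)) true = T * bconv p a ∧
      ∑ j, w j * bsc p (f (x j)) false = T * (1 - bconv p a) := by
    intro f
    refine ⟨_, rfl, ?_, ?_⟩
    · have e : ∀ j, w j * bsc p (f (x j)) true
          = p * w j + (1 - 2 * p) * (if f (x j) then w j else 0) := by
        intro j; cases f (x j) <;> simp [bsc] <;> ring
      simp_rw [e, Finset.sum_add_distrib, ← Finset.mul_sum, bconv, ← hT]
      field_simp
    · have e : ∀ j, w j * bsc p (f (x j)) false
          = (1 - p) * w j - (1 - 2 * p) * (if f (x j) then w j else 0) := by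
        intro j; cases f (x j) <;> simp [bsc] <;> ring
      simp_rw [e, Finset.sum_sub_distrib, ← Finset.mul_sum, bconv, ← hT]
      field_simp
      ring
  obtain ⟨s, hs, hs1, hs0⟩ := hgen bitOne
  obtain ⟨b, hb, hb1, hb0⟩ := hgen bitTwo
  rw [Fintype.sum_bool, hs1, hs0, hb1, hb0]
  have hb_nonneg : 0 ≤ b := by
    rw [hb]
    exact div_nonneg (Finset.sum_nonneg fun j _ => by split_ifs; exacts [hw j, le_rfl]) hpos.le
  have hbs : b ≤ s := by
    rw [hb, hs]
    refine div_le_div_of_nonneg_right (Finset.sum_le_sum fun j _ => ?_) hpos.le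
    have := hw j
    generalize x j = z
    fin_cases z <;> simp [bitOne, bitTwo, this]
  have hs_le : s ≤ 1 := by
    rw [hs, div_le_one hpos, hT]
    refine Finset.sum_le_sum fun j _ => ?_
    split_ifs
    exacts [le_rfl, hw j]
  have key := mul_le_mul_of_nonneg_left
    (normalized_single_letter hp0 hp h1 h2 hb_nonneg hbs hs_le) hpos.le
  have f1 := sum_negMulLog_bool T (bconv p s)
  have f2 := sum_negMulLog_bool T (bconv p b)
  linarith

/-- For every weighted family of input words, the entropy difference of the two outputs is
controlled by a dual certificate. -/
lemma blackwell_tensorized {p : ℝ} (hp0 : 0 < p) (hp : p < 1 / 2) {l : Bool → ℝ} {K : ℝ}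
    (h1 : Real.log 2 - Real.binEntropy p + (p * l true + (1 - p) * l false) = K)
    (h2 : (1 - p) * l true + p * l false = K) {J : Type*} [Fintype J] {n : ℕ} (w : J → ℝ)
    (x : J → Fin n → Fin 3) (hw : ∀ j, 0 ≤ w j) :
    ∑ y, (Real.negMulLog (outLaw (fun a => bsc p (bitOne a)) w x y)
        - Real.negMulLog (outLaw (fun a => bsc p (bitTwo a)) w x y)
        + outLaw (fun a => bsc p (bitTwo a)) w x y * ∑ t, l (y t)) ≤ n * K * ∑ j, w j := by
  have h := tensorize (J := J) (A := fun a => bsc p (bitOne a)) (B := fun a => bsc p (bitTwo a))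
    (fun _ _ => (bsc_pos hp0 hp _ _).le) (fun _ _ => (bsc_pos hp0 hp _ _).le)
    (fun _ => sum_bsc p _) (fun _ => sum_bsc p _) l K
    (fun w x hw => single_letter hp0 hp h1 h2 w x hw)
  exact h n w x hw

/-- A variational form of Fano's inequality. -/
lemma fano {V Y : Type*} [Fintype V] [DecidableEq V] [Fintype Y] (P : V → Y → ℝ) (Q : Y → ℝ) (d : Y → V)
    (hP : ∀ v y, 0 < P v y) (hQ : ∀ y, 0 < Q y) (hP1 : ∀ v, ∑ y, P v y = 1) (hQ1 : ∑ y, Q y = 1) :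
    (∑ v, ∑ y, if d y = v then P v y else 0) * Real.log (Fintype.card V)
        - Fintype.card V * Real.log 2
      ≤ ∑ v, ∑ y, P v y * (Real.log (P v y) - Real.log (Q y)) := by
  set M : ℝ := (Fintype.card V : ℝ) with hM
  set c : V → Y → ℝ := fun v y => (if d y = v then M else 0) / 2 + 1 / 2 with hc
  have hM0 : 0 ≤ M := Nat.cast_nonneg _
  have hc0 : ∀ v y, 0 < c v y := by
    intro v y; simp only [hc]; split_ifs <;> linarith
  have hcs : ∀ y, ∑ v, c v y = M := by
    intro y
    simp only [hc, Finset.sum_add_distrib, ← Finset.sum_div, Finset.sum_ite_eq, Finset.mem_univ,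
      if_true, Finset.sum_const, Finset.card_univ, nsmul_eq_mul, ← hM]
    ring
  have hpt : ∀ v y, P v y * ((if d y = v then Real.log M else 0) - Real.log 2)
      + (P v y - Q y * c v y) ≤ P v y * (Real.log (P v y) - Real.log (Q y)) := by
    intro v y
    have hM1 : 1 ≤ M := by
      rw [hM]; exact_mod_cast Fintype.card_pos_iff.2 ⟨v⟩
    have h1 : (if d y = v then Real.log M else 0) - Real.log 2 ≤ Real.log (c v y) := by
      simp only [hc]
      split_ifs
      · rw [← Real.log_div (by linarith) (by norm_num)]
        exact Real.log_le_log (by linarith) (by linarith)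
      · rw [zero_div, zero_add, Real.log_div one_ne_zero two_ne_zero, Real.log_one]
    have h2 : Real.log (Q y * c v y / P v y) ≤ Q y * c v y / P v y - 1 :=
      Real.log_le_sub_one_of_pos (div_pos (mul_pos (hQ y) (hc0 v y)) (hP v y))
    rw [Real.log_div (mul_pos (hQ y) (hc0 v y)).ne' (hP v y).ne',
      Real.log_mul (hQ y).ne' (hc0 v y).ne'] at h2
    have h3 := mul_le_mul_of_nonneg_left (h1.trans (by linarith :
      Real.log (c v y) ≤ Real.log (P v y) - Real.log (Q y) + (Q y * c v y / P v y - 1)))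
      (hP v y).le
    have h4 : P v y * (Q y * c v y / P v y) = Q y * c v y := by
      field_simp [(hP v y).ne']
    nlinarith
  have hsum := Finset.sum_le_sum fun v (_ : v ∈ Finset.univ) =>
    Finset.sum_le_sum fun y (_ : y ∈ Finset.univ) => hpt v y
  refine le_trans (le_of_eq ?_) hsum
  have e1 : ∑ v, ∑ y, Q y * c v y = M := by
    rw [Finset.sum_comm]
    simp_rw [← Finset.mul_sum, hcs, ← Finset.sum_mul, hQ1, one_mul]
  have e2 : ∑ v, ∑ y, P v y = M := by
    simp_rw [hP1]; simp [hM]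
  have e3 : ∀ v y, P v y * (if d y = v then Real.log M else 0)
      = (if d y = v then P v y else 0) * Real.log M := by
    intro v y; split_ifs <;> simp
  simp_rw [mul_sub, Finset.sum_add_distrib, Finset.sum_sub_distrib, e1, e2, e3,
    ← Finset.sum_mul, e2]
  ring

lemma bsc_prod_pos {p : ℝ} (hp0 : 0 < p) (hp : p < 1 / 2) {n : ℕ} (s y : Fin n → Bool) :
    0 < ∏ t, bsc p (s t) (y t) :=
  Finset.prod_pos fun _ _ => bsc_pos hp0 hp _ _

lemma sum_bsc_prod (p : ℝ) {n : ℕ} (s : Fin n → Bool) :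
    ∑ y : Fin n → Bool, ∏ t, bsc p (s t) (y t) = 1 :=
  sum_prod_kernel (A := bsc p) (fun x => sum_bsc p x) s

lemma sum_log_bsc {p : ℝ} (hp0 : 0 < p) (hp : p < 1 / 2) {n : ℕ} (s : Fin n → Bool) :
    ∑ y : Fin n → Bool, (∏ t, bsc p (s t) (y t)) * Real.log (∏ t, bsc p (s t) (y t))
      = -(n * Real.binEntropy p) := by
  induction n with
  | zero => simp
  | succ n ih =>
    rw [← (Fin.consEquiv fun _ : Fin (n + 1) => Bool).sum_comp, Fintype.sum_prod_type]
    have hce : ∀ b (y : Fin n → Bool), (Fin.consEquiv fun _ : Fin (n + 1) => Bool) (b, y)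
        = (Fin.cons b y : Fin (n + 1) → Bool) := fun _ _ => rfl
    simp only [hce, Fin.prod_univ_succ, Fin.cons_zero, Fin.cons_succ]
    have hl : ∀ b (y : Fin n → Bool), Real.log (bsc p (s 0) b * ∏ t : Fin n, bsc p (s t.succ) (y t))
        = Real.log (bsc p (s 0) b) + Real.log (∏ t : Fin n, bsc p (s t.succ) (y t)) :=
      fun b y => Real.log_mul (bsc_pos hp0 hp _ _).ne'
        (bsc_prod_pos hp0 hp (fun t : Fin n => s t.succ) y).ne'
    have e : ∀ b, ∑ y : Fin n → Bool, bsc p (s 0) b * (∏ t : Fin n, bsc p (s t.succ) (y t))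
        * Real.log (bsc p (s 0) b * ∏ t : Fin n, bsc p (s t.succ) (y t))
        = bsc p (s 0) b * Real.log (bsc p (s 0) b)
          + bsc p (s 0) b * -(n * Real.binEntropy p) := by
      intro b
      have h1 := sum_bsc_prod p (fun t : Fin n => s t.succ)
      have h2 := ih (fun t : Fin n => s t.succ)
      rw [← h2, ← mul_one (bsc p (s 0) b * Real.log (bsc p (s 0) b)), ← h1, Finset.mul_sum,
        Finset.mul_sum, ← Finset.sum_add_distrib]
      refine Finset.sum_congr rfl fun y _ => ?_
      rw [hl]; ring
    simp_rw [e, Finset.sum_add_distrib, ← Finset.sum_mul, sum_bsc]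
    have : ∑ b, bsc p (s 0) b * Real.log (bsc p (s 0) b) = -Real.binEntropy p := by
      rw [Real.binEntropy_eq_negMulLog_add_negMulLog_one_sub]
      cases s 0 <;> simp [bsc, Real.negMulLog] <;> ring
    rw [this]; push_cast; ring

lemma sum_exp_neg_prod {l : Bool → ℝ} (hl : Real.exp (-l true) + Real.exp (-l false) = 1)
    (n : ℕ) : ∑ y : Fin n → Bool, ∏ t, Real.exp (-l (y t)) = 1 := by
  have := sum_prod_kernel (X := Unit) (A := fun _ y => Real.exp (-l y))
    (fun _ => by rw [Fintype.sum_bool]; exact hl) (fun _ : Fin n => ())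
  exact this

/-- A sum-rate converse for codes over the Blackwell channel without feedback. -/
lemma sum_rate_bound {p : ℝ} (hp0 : 0 < p) (hp : p < 1 / 2) {l : Bool → ℝ} {K : ℝ}
    (hl : Real.exp (-l true) + Real.exp (-l false) = 1)
    (h1 : Real.log 2 - Real.binEntropy p + (p * l true + (1 - p) * l false) = K)
    (h2 : (1 - p) * l true + p * l false = K)
    {V J : Type*} [Fintype V] [Fintype J] [DecidableEq V] [DecidableEq J] [Nonempty V] [Nonempty J] {n : ℕ}
    (x : V → J → Fin n → Fin 3) (d1 : (Fin n → Bool) → J) (d2 : (Fin n → Bool) → V) :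
    (∑ v, ∑ j, ∑ y, if d1 y = j then ∏ t, bsc p (bitOne (x v j t)) (y t) else 0)
        * Real.log (Fintype.card J)
      + (∑ v, ∑ j, ∑ y, if d2 y = v then ∏ t, bsc p (bitTwo (x v j t)) (y t) else 0)
        * Real.log (Fintype.card V)
      - 2 * (Fintype.card V * Fintype.card J) * Real.log 2
      ≤ (Fintype.card V * Fintype.card J) * (n * (K - Real.binEntropy p)) := by
  set N : ℝ := (Fintype.card J : ℝ) with hN
  set M : ℝ := (Fintype.card V : ℝ) with hM
  have hNpos : 0 < N := by rw [hN]; exact_mod_cast Fintype.card_pos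
  have hMpos : 0 < M := by rw [hM]; exact_mod_cast Fintype.card_pos
  set P1 : V → (Fin n → Bool) → ℝ :=
    fun v => outLaw (fun a => bsc p (bitOne a)) (fun _ : J => 1 / N) (x v) with hP1
  set P2 : V → (Fin n → Bool) → ℝ :=
    fun v => outLaw (fun a => bsc p (bitTwo a)) (fun _ : J => 1 / N) (x v) with hP2
  have hpos : ∀ (f : Fin 3 → Bool) v y,
      0 < outLaw (fun a => bsc p (f a)) (fun _ : J => 1 / N) (x v) y := fun f v y =>
    Finset.sum_pos (fun j _ => mul_pos (by positivity) (bsc_prod_pos hp0 hp _ _))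
      Finset.univ_nonempty
  have hw1 : ∑ _ : J, (1 / N) = 1 := by
    rw [Finset.sum_const, Finset.card_univ, nsmul_eq_mul, ← hN]; field_simp
  have hsum : ∀ (f : Fin 3 → Bool) v,
      ∑ y, outLaw (fun a => bsc p (f a)) (fun _ : J => 1 / N) (x v) y = 1 := fun f v => by
    rw [sum_outLaw fun a => sum_bsc p (f a), hw1]
  have hten : ∀ v, ∑ y, (Real.negMulLog (P1 v y) - Real.negMulLog (P2 v y)
      + P2 v y * ∑ t, l (y t)) ≤ n * K := fun v => by
    have := blackwell_tensorized hp0 hp h1 h2 (fun _ : J => 1 / N) (x v) fun _ => by positivity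
    rwa [hw1, mul_one] at this
  have hlogQ : ∀ y : Fin n → Bool,
      Real.log (∏ t, Real.exp (-l (y t))) = -∑ t, l (y t) := fun y => by
    rw [← Real.exp_sum, Real.log_exp, Finset.sum_neg_distrib]
  have F2 := fano P2 (fun y => ∏ t, Real.exp (-l (y t))) d2 (fun v y => hpos _ v y)
    (fun y => Finset.prod_pos fun _ _ => Real.exp_pos _) (fun v => hsum _ v)
    (sum_exp_neg_prod hl n)
  have F1 : ∀ v, (∑ j, ∑ y, if d1 y = j then ∏ t, bsc p (bitOne (x v j t)) (y t) else 0) * Real.log N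
      - N * Real.log 2 ≤ ∑ j, ∑ y, (∏ t, bsc p (bitOne (x v j t)) (y t))
      * (Real.log (∏ t, bsc p (bitOne (x v j t)) (y t)) - Real.log (P1 v y)) := fun v =>
    fano (fun j (y : Fin n → Bool) => ∏ t, bsc p (bitOne (x v j t)) (y t)) (P1 v) d1
    (fun j y => bsc_prod_pos hp0 hp _ _) (fun y => hpos _ v y) (fun j => sum_bsc_prod p _)
    (hsum _ v)
  have e1 : ∀ v, ∑ j, ∑ y, (∏ t, bsc p (bitOne (x v j t)) (y t))
      * (Real.log (∏ t, bsc p (bitOne (x v j t)) (y t)) - Real.log (P1 v y))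
      = N * ∑ y, Real.negMulLog (P1 v y) - N * (n * Real.binEntropy p) := by
    intro v
    simp_rw [mul_sub, Finset.sum_sub_distrib]
    have a1 : ∑ j, ∑ y : Fin n → Bool, (∏ t, bsc p (bitOne (x v j t)) (y t))
      * Real.log (∏ t, bsc p (bitOne (x v j t)) (y t)) = -(N * (n * Real.binEntropy p)) := by
      simp_rw [sum_log_bsc hp0 hp]
      rw [Finset.sum_const, Finset.card_univ, nsmul_eq_mul, ← hN]; ring
    have a2 : ∑ j, ∑ y : Fin n → Bool, (∏ t, bsc p (bitOne (x v j t)) (y t))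
        * Real.log (P1 v y) = -(N * ∑ y, Real.negMulLog (P1 v y)) := by
      rw [Finset.sum_comm, Finset.mul_sum, ← Finset.sum_neg_distrib]
      refine Finset.sum_congr rfl fun y _ => ?_
      rw [← Finset.sum_mul, Real.negMulLog]
      have : N * P1 v y = ∑ j, ∏ t, bsc p (bitOne (x v j t)) (y t) := by
        rw [hP1]
        simp only [outLaw]
        rw [← Finset.mul_sum]; field_simp
      rw [← this]; ring
    rw [a1, a2]; ring
  have e2 : ∑ v, ∑ y, P2 v y * (Real.log (P2 v y) - Real.log (∏ t, Real.exp (-l (y t))))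
      = ∑ v, ∑ y, (-Real.negMulLog (P2 v y) + P2 v y * ∑ t, l (y t)) := by
    refine Finset.sum_congr rfl fun v _ => Finset.sum_congr rfl fun y _ => ?_
    rw [hlogQ, Real.negMulLog]; ring
  have e3 : N * (∑ v, ∑ y, if d2 y = v then P2 v y else 0)
      = ∑ v, ∑ j, ∑ y, if d2 y = v then ∏ t, bsc p (bitTwo (x v j t)) (y t) else 0 := by
    rw [Finset.mul_sum]
    refine Finset.sum_congr rfl fun v _ => ?_
    rw [Finset.sum_comm, Finset.mul_sum]
    refine Finset.sum_congr rfl fun y _ => ?_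
    split_ifs
    · rw [hP2]
      simp only [outLaw]
      rw [← Finset.mul_sum]; field_simp
    · simp
  have F1' := Finset.sum_le_sum fun v (_ : v ∈ Finset.univ) => F1 v
  have T' := Finset.sum_le_sum fun v (_ : v ∈ Finset.univ) => hten v
  simp_rw [e1, Finset.sum_sub_distrib, ← Finset.sum_mul, ← Finset.mul_sum] at F1'
  rw [e2] at F2
  simp only [Finset.sum_add_distrib, Finset.sum_sub_distrib, Finset.sum_neg_distrib,
    Finset.sum_const, Finset.card_univ, nsmul_eq_mul, ← hM] at F1' F2 T'
  have F2' := mul_le_mul_of_nonneg_left F2 hNpos.le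
  have T2 := mul_le_mul_of_nonneg_left T' hNpos.le
  rw [mul_sub, ← mul_assoc, e3] at F2'
  linarith

lemma sum_blackwellW_fst (p : ℝ) {n : ℕ} (x : Fin n → Fin 3) (g : (Fin n → Bool) → ℝ) :
    ∑ y : Fin n → Bool × Bool, (∏ t, blackwellW p (x t) (y t)) * g (fun t => (y t).1)
      = ∑ u : Fin n → Bool, (∏ t, bsc p (bitOne (x t)) (u t)) * g u := by
  rw [sum_pi_comp (fun t => blackwellW p (x t)) Prod.fst g]
  simp_rw [← blackwellW_fst]
  refine Finset.sum_congr rfl fun u _ => ?_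
  congr 1
  exact Finset.prod_congr rfl fun t _ => Finset.sum_congr rfl fun y _ => by congr

lemma sum_blackwellW_snd (p : ℝ) {n : ℕ} (x : Fin n → Fin 3) (g : (Fin n → Bool) → ℝ) :
    ∑ y : Fin n → Bool × Bool, (∏ t, blackwellW p (x t) (y t)) * g (fun t => (y t).2)
      = ∑ u : Fin n → Bool, (∏ t, bsc p (bitTwo (x t)) (u t)) * g u := by
  rw [sum_pi_comp (fun t => blackwellW p (x t)) Prod.snd g]
  simp_rw [← blackwellW_snd]
  refine Finset.sum_congr rfl fun u _ => ?_
  congr 1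
  exact Finset.prod_congr rfl fun t _ => Finset.sum_congr rfl fun y _ => by congr

lemma msgCard_pos {n : ℕ} {R : ℝ} (hR : 0 ≤ R) : 0 < msgCard n R := by
  unfold msgCard
  exact Nat.floor_pos.2 (Real.one_le_rpow one_le_two (by positivity))

lemma log_msgCard_ge {n : ℕ} {R : ℝ} (hR : 0 ≤ R) :
    n * R * Real.log 2 - Real.log 2 ≤ Real.log (msgCard n R) := by
  have h1 : (1 : ℝ) ≤ msgCard n R := by exact_mod_cast msgCard_pos hR
  have h2 : (2 : ℝ) ^ ((n : ℝ) * R) < msgCard n R + 1 := Nat.lt_floor_add_one _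
  have h3 : (2 : ℝ) ^ ((n : ℝ) * R) ≤ msgCard n R * 2 := by linarith
  have h4 := Real.log_le_log (by positivity) h3
  rw [Real.log_rpow two_pos, Real.log_mul (by positivity) two_ne_zero] at h4
  linarith

lemma errProbNoFB_bound {p : ℝ} (hp0 : 0 < p) (hp : p < 1 / 2) {l : Bool → ℝ} {K : ℝ}
    (hl : Real.exp (-l true) + Real.exp (-l false) = 1)
    (h1 : Real.log 2 - Real.binEntropy p + (p * l true + (1 - p) * l false) = K)
    (h2 : (1 - p) * l true + p * l false = K) {n : ℕ} {R0 R1 R2 : ℝ}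
    (hR0 : 0 ≤ R0) (hR1 : 0 ≤ R1) (hR2 : 0 ≤ R2)
    (enc : Fin (msgCard n R0) × Fin (msgCard n R1) × Fin (msgCard n R2) → Fin n → Fin 3)
    (dec1 : (Fin n → Bool) → Fin (msgCard n R0) × Fin (msgCard n R1))
    (dec2 : (Fin n → Bool) → Fin (msgCard n R0) × Fin (msgCard n R2)) :
    (1 - errProbNoFB (blackwellW p) n R0 R1 R2 enc dec1 dec2)
        * (Real.log (msgCard n R0) + Real.log (msgCard n R1) + Real.log (msgCard n R2))
      - 2 * Real.log 2 ≤ n * (K - Real.binEntropy p) := by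
  have hM0 := msgCard_pos (n := n) hR0
  have hM1 := msgCard_pos (n := n) hR1
  have hM2 := msgCard_pos (n := n) hR2
  set Pe := errProbNoFB (blackwellW p) n R0 R1 R2 enc dec1 dec2 with hPe
  unfold errProbNoFB at hPe
  have : Nonempty (Fin (msgCard n R0)) := ⟨⟨0, hM0⟩⟩
  have : Nonempty (Fin (msgCard n R1)) := ⟨⟨0, hM1⟩⟩
  have : Nonempty (Fin (msgCard n R2)) := ⟨⟨0, hM2⟩⟩
  set bad : Fin (msgCard n R0) × Fin (msgCard n R1) × Fin (msgCard n R2) →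
    (Fin n → Bool × Bool) → ℝ := fun m y =>
    (if dec1 (fun t => (y t).1) ≠ (m.1, m.2.1) ∨ dec2 (fun t => (y t).2) ≠ (m.1, m.2.2)
            then 1 else 0) with hbad
  have hW : ∀ (x : Fin n → Fin 3) (y : Fin n → Bool × Bool), 0 ≤ ∏ t, blackwellW p (x t) (y t) := fun x y =>
    Finset.prod_nonneg fun _ _ => blackwellW_nonneg hp0 hp _ _
  have hW1 : ∀ x : Fin n → Fin 3, ∑ y : Fin n → Bool × Bool, ∏ t, blackwellW p (x t) (y t) = 1 := by
    intro x
    have := sum_blackwellW_fst p x fun _ => 1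
    simpa only [mul_one, sum_bsc_prod] using this
  have hs1 : ∀ m, 1 - ∑ y, (∏ t, blackwellW p (enc m t) (y t)) * bad m y
      ≤ ∑ u, if (dec1 u).2 = m.2.1 then ∏ t, bsc p (bitOne (enc m t)) (u t) else 0 := by
    intro m
    have := sum_blackwellW_fst p (enc m) fun u => if (dec1 u).2 = m.2.1 then 1 else 0
    simp only [mul_ite, mul_one, mul_zero] at this
    rw [← this, ← hW1 (enc m), ← Finset.sum_sub_distrib]
    refine Finset.sum_le_sum fun y _ => ?_
    have := hW (enc m) y
    simp only [hbad]
    split_ifs with ha hb hb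
    · linarith
    · linarith
    · linarith
    · push Not at ha
      exact absurd (by rw [ha.1]) hb
  have hs2 : ∀ m, 1 - ∑ y, (∏ t, blackwellW p (enc m t) (y t)) * bad m y
      ≤ ∑ u, if dec2 u = (m.1, m.2.2) then ∏ t, bsc p (bitTwo (enc m t)) (u t) else 0 := by
    intro m
    have := sum_blackwellW_snd p (enc m) fun u => if dec2 u = (m.1, m.2.2) then 1 else 0
    simp only [mul_ite, mul_one, mul_zero] at this
    rw [← this, ← hW1 (enc m), ← Finset.sum_sub_distrib]
    refine Finset.sum_le_sum fun y _ => ?_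
    have := hW (enc m) y
    simp only [hbad]
    split_ifs with ha hb hb
    · linarith
    · linarith
    · linarith
    · push Not at ha
      exact absurd ha.2 hb
  have key := sum_rate_bound hp0 hp hl h1 h2
    (fun (v : Fin (msgCard n R0) × Fin (msgCard n R2)) (j : Fin (msgCard n R1)) =>
      enc (v.1, j, v.2)) (fun y => (dec1 y).2) dec2
  set M : ℝ := (msgCard n R0 : ℝ) * msgCard n R1 * msgCard n R2 with hM
  have hMpos : 0 < M := by positivity
  have hre : ∀ F : Fin (msgCard n R0) × Fin (msgCard n R1) × Fin (msgCard n R2) → ℝ,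
      ∑ v : Fin (msgCard n R0) × Fin (msgCard n R2), ∑ j, F (v.1, j, v.2) = ∑ m, F m := by
    intro F
    simp only [Fintype.sum_prod_type]
    exact Finset.sum_congr rfl fun i _ => Finset.sum_comm
  have hsum : M * (1 - Pe)
      = ∑ m, (1 - ∑ y, (∏ t, blackwellW p (enc m t) (y t)) * bad m y) := by
    rw [Finset.sum_sub_distrib, hPe]
    simp only [Finset.sum_const, Finset.card_univ, Fintype.card_prod, Fintype.card_fin,
      nsmul_eq_mul]
    push_cast
    rw [mul_sub, hM]
    field_simp
    simp only [hbad]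
  have hl0 : 0 ≤ Real.log (msgCard n R0) := Real.log_natCast_nonneg _
  have hl1 : 0 ≤ Real.log (msgCard n R1) := Real.log_natCast_nonneg _
  have hl2 : 0 ≤ Real.log (msgCard n R2) := Real.log_natCast_nonneg _
  have r1 := hre fun m =>
    ∑ u, if (dec1 u).2 = m.2.1 then ∏ t, bsc p (bitOne (enc m t)) (u t) else 0
  have r2 := hre fun m =>
    ∑ u, if dec2 u = (m.1, m.2.2) then ∏ t, bsc p (bitTwo (enc m t)) (u t) else 0
  simp only [Prod.mk.eta] at r1 r2
  rw [r1, r2] at key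
  have b1 := mul_le_mul_of_nonneg_right
    (hsum.le.trans (Finset.sum_le_sum fun m _ => hs1 m)) hl1
  have b2 := mul_le_mul_of_nonneg_right
    (hsum.le.trans (Finset.sum_le_sum fun m _ => hs2 m)) (add_nonneg hl0 hl2)
  simp only [Fintype.card_prod, Fintype.card_fin, Nat.cast_mul] at key
  rw [Real.log_mul (by positivity) (by positivity)] at key
  have hMM : (msgCard n R0 : ℝ) * msgCard n R2 * msgCard n R1 = M := by rw [hM]; ring
  rw [hMM] at key
  refine le_of_mul_le_mul_left ?_ hMpos
  linarith

/-- The sum-rate outer bound on the capacity region without feedback. -/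
lemma CNoFB_sum_rate {p : ℝ} (hp0 : 0 < p) (hp : p < 1 / 2) {l : Bool → ℝ} {K : ℝ}
    (hl : Real.exp (-l true) + Real.exp (-l false) = 1)
    (h1 : Real.log 2 - Real.binEntropy p + (p * l true + (1 - p) * l false) = K)
    (h2 : (1 - p) * l true + p * l false = K) {r : ℝ × ℝ × ℝ}
    (hr : r ∈ CNoFB (blackwellW p)) :
    (r.1 + r.2.1 + r.2.2) * Real.log 2 ≤ K - Real.binEntropy p := by
  have hclosed : IsClosed {r : ℝ × ℝ × ℝ |
      (r.1 + r.2.1 + r.2.2) * Real.log 2 ≤ K - Real.binEntropy p} :=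
    isClosed_le (by fun_prop) continuous_const
  refine closure_minimal ?_ hclosed hr
  rintro ⟨R0, R1, R2⟩ ⟨hR0, hR1, hR2, enc, dec1, dec2, hlim⟩
  simp only [Set.mem_ofPred_eq] at *
  set e := fun n => errProbNoFB (blackwellW p) n R0 R1 R2 (enc n) (dec1 n) (dec2 n) with he
  have hinv : Filter.Tendsto (fun n : ℕ => (1 : ℝ) / n) Filter.atTop (nhds 0) :=
    tendsto_one_div_atTop_nhds_zero_nat
  have hl1 : Filter.Tendsto (fun n : ℕ => (1 - e n)
      * ((R0 + R1 + R2) * Real.log 2 - 3 * Real.log 2 * (1 / n)) - 2 * Real.log 2 * (1 / n))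
      Filter.atTop (nhds ((R0 + R1 + R2) * Real.log 2)) := by
    have := ((tendsto_const_nhds (x := (1 : ℝ))).sub hlim).mul
      ((tendsto_const_nhds (x := (R0 + R1 + R2) * Real.log 2)).sub
        (hinv.const_mul (3 * Real.log 2))) |>.sub (hinv.const_mul (2 * Real.log 2))
    simpa using this
  refine le_of_tendsto hl1 ?_
  have hev : ∀ᶠ n in Filter.atTop, e n < 1 := hlim.eventually (gt_mem_nhds one_pos)
  filter_upwards [hev, Filter.eventually_gt_atTop 0] with n hn hn0
  have hb := errProbNoFB_bound hp0 hp hl h1 h2 hR0 hR1 hR2 (enc n) (dec1 n) (dec2 n)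
  have hnpos : (0 : ℝ) < n := by exact_mod_cast hn0
  have hm := add_le_add (add_le_add (log_msgCard_ge (n := n) hR0) (log_msgCard_ge (n := n) hR1))
    (log_msgCard_ge (n := n) hR2)
  have hm' := mul_le_mul_of_nonneg_left hm (sub_nonneg.2 hn.le)
  refine le_of_mul_le_mul_left ?_ hnpos
  have e1 : (n : ℝ) * ((1 - e n) * ((R0 + R1 + R2) * Real.log 2 - 3 * Real.log 2 * (1 / n))
      - 2 * Real.log 2 * (1 / n)) = (1 - e n) * (n * R0 * Real.log 2 - Real.log 2 +
        (n * R1 * Real.log 2 - Real.log 2) + (n * R2 * Real.log 2 - Real.log 2))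
        - 2 * Real.log 2 := by
    field_simp; ring
  rw [e1]
  linarith

/-- Ignoring feedback embeds the region without feedback. -/
lemma CNoFB_subset_CGenFB (p : ℝ) {Q : Bool × Bool → ℝ} (hQ : IsPMF Q) :
    CNoFB (blackwellW p) ⊆ CGenFB (blackwellNoisyW p Q) := by
  refine closure_mono ?_
  rintro ⟨R0, R1, R2⟩ ⟨hR0, hR1, hR2, enc, dec1, dec2, hlim⟩
  refine ⟨hR0, hR1, hR2, fun n t m _ => enc n m t, dec1, dec2, fun n t m fb fb' _ => rfl, ?_⟩
  refine hlim.congr fun n => ?_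
  unfold errProbNoFB errProbFB
  congr 1
  refine Finset.sum_congr rfl fun m _ => ?_
  have h := sum_pi_comp (fun t => blackwellNoisyW p Q (enc n m t))
    (fun y : Bool × Bool × (Bool × Bool) => (y.1, y.2.1))
    (fun y => if dec1 n (fun t => (y t).1) ≠ (m.1, m.2.1) ∨
      dec2 n (fun t => (y t).2) ≠ (m.1, m.2.2) then 1 else 0)
  refine Eq.trans ?_ h.symm
  refine Finset.sum_congr rfl fun y _ => ?_
  congr 1
  refine Finset.prod_congr rfl fun t _ => ?_
  have hQ1 : Q (true, true) + Q (true, false) + (Q (false, true) + Q (false, false)) = 1 := by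
    have := hQ.2
    simpa [Fintype.sum_prod_type] using this
  generalize enc n m t = x
  obtain ⟨a, b⟩ := y t
  have hsum : ∑ z : Bool × Bool × (Bool × Bool),
      (if (z.1, z.2.1) = (a, b) then blackwellNoisyW p Q x z else 0) = blackwellW p x (a, b) := by
    cases a <;> cases b <;> simp [Fintype.sum_prod_type, blackwellNoisyW] <;>
      linear_combination blackwellW p x _ * hQ1
  rw [← hsum]
  exact Finset.sum_congr rfl fun z _ => by congr

lemma eventually_quadratic_lt_pow {r : ℝ} (hr : 1 < r) :
    ∀ᶠ k : ℕ in Filter.atTop, 4 * (k : ℝ) * (k + 1) < r ^ k := by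
  have hr0 : 0 < r := by linarith
  have h := tendsto_pow_const_mul_const_pow_of_abs_lt_one 2 (r := r⁻¹)
    (by rw [abs_of_pos (inv_pos.2 hr0)]; exact inv_lt_one_of_one_lt₀ hr)
  filter_upwards [h.eventually (gt_mem_nhds (show (0 : ℝ) < 1 / 8 by norm_num)),
    Filter.eventually_ge_atTop 1] with k hk hk1
  have hk1' : (1 : ℝ) ≤ k := by exact_mod_cast hk1
  have hpos : 0 < r ^ k := pow_pos hr0 k
  rw [inv_pow, ← div_eq_mul_inv, div_lt_iff₀ hpos] at hk
  nlinarith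

/-- Binary words lying above a given word. -/
lemma card_above {k : ℕ} (b : Fin k → Bool) :
    (Finset.univ.filter fun s : Fin k → Bool => ∀ i, b i = true → s i = true).card
      = ∏ i, if b i then 1 else 2 := by
  have e : (Finset.univ.filter fun s : Fin k → Bool => ∀ i, b i = true → s i = true)
      = Fintype.piFinset fun i => if b i then {true} else Finset.univ := by
    ext s
    simp only [Finset.mem_filter, Finset.mem_univ, true_and, Fintype.mem_piFinset]
    refine forall_congr' fun i => ?_
    cases b i <;> simp
  rw [e, Fintype.card_piFinset]
  refine Finset.prod_congr rfl fun i _ => ?_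
  cases b i <;> simp

/-- Colorings avoiding one color on a given set are rare. -/
lemma card_coloring_avoiding {S : Type*} [Fintype S] [DecidableEq S] (M : ℕ) (T : Finset S)
    (a : Fin M) :
    ((Finset.univ.filter fun c : S → Fin M => ∀ s ∈ T, c s ≠ a).card : ℝ)
      ≤ (M : ℝ) ^ Fintype.card S * Real.exp (-(T.card / M)) := by
  have hM : (0 : ℝ) < M := by exact_mod_cast a.pos
  have e : (Finset.univ.filter fun c : S → Fin M => ∀ s ∈ T, c s ≠ a)
      = Fintype.piFinset fun s => if s ∈ T then Finset.univ.erase a else Finset.univ := by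
    ext c
    simp only [Finset.mem_filter, Finset.mem_univ, true_and, Fintype.mem_piFinset]
    refine forall_congr' fun s => ?_
    by_cases h : s ∈ T <;> simp [h]
  rw [e, Fintype.card_piFinset]
  push_cast
  have hle : ∀ s, (((if s ∈ T then Finset.univ.erase a else Finset.univ : Finset (Fin M)).card : ℕ) : ℝ)
      ≤ M * (if s ∈ T then Real.exp (-(1 / M)) else 1) := by
    intro s
    split_ifs
    · rw [Finset.card_erase_of_mem (Finset.mem_univ a), Finset.card_univ, Fintype.card_fin,
        Nat.cast_sub a.pos]
      have := Real.add_one_le_exp (-(1 / (M : ℝ)))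
      have h2 := mul_le_mul_of_nonneg_left this hM.le
      have h3 : (M : ℝ) * (-(1 / M) + 1) = M - 1 := by field_simp; ring
      rw [h3] at h2
      exact_mod_cast h2
    · simp
  refine (Finset.prod_le_prod (fun s _ => Nat.cast_nonneg _) fun s _ => hle s).trans (le_of_eq ?_)
  rw [Finset.prod_mul_distrib, Finset.prod_const, Finset.card_univ, Finset.prod_ite_mem,
    Finset.univ_inter, Finset.prod_const, ← Real.exp_nat_mul]
  congr 2
  ring

lemma exists_weight_class (k : ℕ) :
    ∃ w : ℕ, (3 : ℕ) ^ k ≤ (k + 1) * ((Finset.univ.filter fun b : Fin k → Bool =>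
      (∏ i, if b i then 1 else 2) = 2 ^ w).card * 2 ^ w) := by
  have hsum : ∑ b : Fin k → Bool, ∏ i, (if b i then 1 else 2) = 3 ^ k := by
    have := (Finset.prod_univ_sum (fun _ : Fin k => (Finset.univ : Finset Bool))
      fun _ y => if y then 1 else 2).symm
    rw [Fintype.piFinset_univ] at this
    rw [this]; simp
  set f : (Fin k → Bool) → ℕ := fun b => (Finset.univ.filter fun i => b i = false).card with hf
  have hpow : ∀ b : Fin k → Bool, (∏ i, if b i then 1 else 2) = 2 ^ f b := by
    intro b
    rw [hf, ← Finset.prod_const, Finset.prod_filter]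
    refine Finset.prod_congr rfl fun i _ => ?_
    cases b i <;> simp
  have hmaps : ∀ b ∈ (Finset.univ : Finset (Fin k → Bool)), f b ∈ Finset.range (k + 1) := by
    intro b _
    rw [Finset.mem_range, Nat.lt_succ_iff]
    exact (Finset.card_filter_le _ _).trans (by simp)
  by_contra! hcon
  have hfib := Finset.sum_fiberwise_of_maps_to hmaps fun b => ∏ i, (if b i then 1 else 2)
  rw [hsum] at hfib
  have hb : ∀ w ∈ Finset.range (k + 1), (k + 1) * (∑ b with f b = w, ∏ i, (if b i then 1 else 2))
      < 3 ^ k := by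
    intro w _
    refine lt_of_eq_of_lt ?_ (hcon w)
    congr 1
    have : (Finset.univ.filter fun b : Fin k → Bool => (∏ i, if b i then 1 else 2) = 2 ^ w)
        = Finset.univ.filter fun b => f b = w := by
      ext b
      simp [hpow]
    rw [this, ← smul_eq_mul, ← Finset.sum_const]
    refine Finset.sum_congr rfl fun b hb => ?_
    rw [hpow, (Finset.mem_filter.1 hb).2]
  have := Finset.sum_lt_sum_of_nonempty (s := Finset.range (k + 1)) (by simp) hb
  rw [← Finset.mul_sum, hfib] at this
  simp at this

/-- Codes for the noiseless Blackwell channel of sum rate arbitrarily close to `log 3`. -/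
lemma exists_inner_code {δ : ℝ} (hδ : 0 < δ) :
    ∃ (k M1 M2 : ℕ) (enc : Fin M1 → Fin M2 → Fin k → Fin 3), 1 ≤ k ∧ 2 ≤ M1 ∧ 2 ≤ M2 ∧
      (∀ a b a' b', (∀ t, bitOne (enc a b t) = bitOne (enc a' b' t)) → a = a') ∧
      (∀ a b a' b', (∀ t, bitTwo (enc a b t) = bitTwo (enc a' b' t)) → b = b') ∧
      k * (Real.log 3 - δ) ≤ Real.log M1 + Real.log M2 := by
  obtain ⟨k, hk1, hkδ, hk32⟩ := ((Filter.eventually_ge_atTop 1).and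
    ((eventually_quadratic_lt_pow (Real.one_lt_exp_iff.2 hδ)).and
      (eventually_quadratic_lt_pow (show (1 : ℝ) < 3 / 2 by norm_num)))).exists
  have hk32' : 4 * k * (k + 1) * 2 ^ k < 3 ^ k := by
    rw [div_pow, lt_div_iff₀ (by positivity)] at hk32
    exact_mod_cast hk32
  obtain ⟨w, hw⟩ := exists_weight_class k
  set B := Finset.univ.filter fun b : Fin k → Bool => (∏ i, if b i then 1 else 2) = 2 ^ w with hB
  set M2 := B.card with hM2
  set N := 2 ^ w with hN
  set M1 := N / (2 * k) with hM1
  have h2k : 0 < 2 * k := by omega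
  have hM2le : M2 ≤ 2 ^ k := by
    refine (Finset.card_filter_le _ _).trans (by simp)
  have hM2pos : 0 < M2 := by
    rcases Nat.eq_zero_or_pos M2 with h | h
    · rw [h] at hw; simp at hw
    · exact h
  have hNle : N ≤ 2 ^ k := by
    obtain ⟨b, hb⟩ := Finset.card_pos.1 hM2pos
    rw [hN, ← (Finset.mem_filter.1 hb).2]
    calc (∏ i, if b i then 1 else 2) ≤ ∏ _ : Fin k, 2 :=
          Finset.prod_le_prod' fun i _ => by split_ifs <;> norm_num
      _ = 2 ^ k := by simp
  have hN4k : 4 * k < N := by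
    by_contra! h
    have : (k + 1) * (M2 * N) ≤ (k + 1) * (2 ^ k * (4 * k)) := by gcongr
    nlinarith
  have hM22 : 2 ≤ M2 := by
    by_contra! h
    have : (k + 1) * (M2 * N) ≤ (k + 1) * (1 * 2 ^ k) := by gcongr; omega
    nlinarith [Nat.zero_le (k * 2 ^ k), pow_pos (show 0 < 2 by norm_num) k]
  have hM12 : 2 ≤ M1 := by
    rw [hM1, Nat.le_div_iff_mul_le h2k]; omega
  have hM1N : N ≤ 4 * k * M1 := by
    have : N < 2 * k * (M1 + 1) := by
      have := Nat.lt_mul_div_succ N h2k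
      rwa [← hM1] at this
    nlinarith
  have hM1N' : M1 * (2 * k) ≤ N := Nat.div_mul_le_self _ _
  have habove : ∀ b ∈ B, (Finset.univ.filter fun s : Fin k → Bool =>
      ∀ i, b i = true → s i = true).card = N := fun b hb => by
    rw [card_above, (Finset.mem_filter.1 hb).2]
  have hcol : ∃ c : (Fin k → Bool) → Fin M1, ∀ b ∈ B, ∀ a : Fin M1,
      ∃ s : Fin k → Bool, (∀ i, b i = true → s i = true) ∧ c s = a := by
    by_contra! hcon
    have hcover : (Finset.univ : Finset ((Fin k → Bool) → Fin M1)) ⊆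
        (B ×ˢ (Finset.univ : Finset (Fin M1))).biUnion fun q =>
          Finset.univ.filter fun c => ∀ s ∈ (Finset.univ.filter fun s : Fin k → Bool =>
            ∀ i, q.1 i = true → s i = true), c s ≠ q.2 := by
      intro c _
      obtain ⟨b, hb, a, ha⟩ := hcon c
      rw [Finset.mem_biUnion]
      refine ⟨(b, a), Finset.mem_product.2 ⟨hb, Finset.mem_univ a⟩, ?_⟩
      simpa using ha
    have hcard := (Finset.card_le_card hcover).trans Finset.card_biUnion_le
    have hcardR : (M1 : ℝ) ^ Fintype.card (Fin k → Bool) ≤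
        ∑ q ∈ B ×ˢ (Finset.univ : Finset (Fin M1)),
          (M1 : ℝ) ^ Fintype.card (Fin k → Bool) * Real.exp (-((N : ℕ) / M1)) := by
      have h1 : ((Finset.univ : Finset ((Fin k → Bool) → Fin M1)).card : ℝ)
          = (M1 : ℝ) ^ Fintype.card (Fin k → Bool) := by
        rw [Finset.card_univ, Fintype.card_fun]; simp
      rw [← h1]
      refine (Nat.cast_le.2 hcard).trans ?_
      push_cast
      refine Finset.sum_le_sum fun q hq => ?_
      have := card_coloring_avoiding M1 (Finset.univ.filter fun s : Fin k → Bool =>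
            ∀ i, q.1 i = true → s i = true) q.2
      rw [habove q.1 (Finset.mem_product.1 hq).1, ← h1] at this
      convert this using 2
    rw [Finset.sum_const, Finset.card_product, Finset.card_univ, Fintype.card_fin, nsmul_eq_mul]
      at hcardR
    have hMM : (0 : ℝ) < (M1 : ℝ) ^ Fintype.card (Fin k → Bool) :=
      pow_pos (by exact_mod_cast (by omega : 0 < M1)) _
    have h1 : 1 ≤ ((M2 * M1 : ℕ) : ℝ) * Real.exp (-((N : ℕ) / M1)) := by
      refine le_of_mul_le_mul_left ?_ hMM
      rw [mul_one]
      refine hcardR.trans (le_of_eq ?_)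
      ring
    have hM1pos : (0 : ℝ) < M1 := by exact_mod_cast (by omega : 0 < M1)
    have h2 : (2 * k : ℝ) ≤ (N : ℕ) / M1 := by
      rw [le_div_iff₀ hM1pos]
      have : ((M1 * (2 * k) : ℕ) : ℝ) ≤ (N : ℕ) := Nat.cast_le.2 hM1N'
      push_cast at this ⊢
      linarith
    have h3 : ((M2 * M1 : ℕ) : ℝ) ≤ 4 ^ k := by
      have hM1le : M1 ≤ 2 ^ k := (Nat.div_le_self _ _).trans hNle
      have : M2 * M1 ≤ 2 ^ k * 2 ^ k := Nat.mul_le_mul hM2le hM1le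
      rw [← mul_pow] at this
      exact_mod_cast this
    have h4 : (4 : ℝ) ^ k < Real.exp (2 * k) := by
      have : (4 : ℝ) < Real.exp 2 := by
        have h := Real.exp_one_gt_d9
        have e : Real.exp 2 = Real.exp 1 * Real.exp 1 := by rw [← Real.exp_add]; norm_num
        rw [e]; nlinarith
      rw [mul_comm, Real.exp_nat_mul]
      exact pow_lt_pow_left₀ this (by norm_num) (by omega)
    have h5 : Real.exp (-((N : ℕ) / M1)) ≤ Real.exp (-(2 * k)) := Real.exp_le_exp.2 (by linarith)
    have h6 : ((M2 * M1 : ℕ) : ℝ) * Real.exp (-((N : ℕ) / M1)) ≤ 4 ^ k * Real.exp (-(2 * k)) :=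
      mul_le_mul h3 h5 (Real.exp_pos _).le (by positivity)
    have h7 : (4 : ℝ) ^ k * Real.exp (-(2 * k)) < 1 := by
      rw [Real.exp_neg, ← div_eq_mul_inv, div_lt_one (Real.exp_pos _)]
      exact h4
    linarith
  obtain ⟨c, hc⟩ := hcol
  choose! S hS1 hS2 using hc
  let β : Fin M2 → (Fin k → Bool) := fun j => (B.equivFin.symm j : Fin k → Bool)
  have hβ : ∀ j, β j ∈ B := fun j => (B.equivFin.symm j).2
  have hbit1 : ∀ a j t, bitOne (if β j t then 2 else if S (β j) a t then 1 else 0)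
      = S (β j) a t := by
    intro a j t
    have := hS1 (β j) (hβ j) a t
    cases h1 : β j t <;> cases h2 : S (β j) a t <;> simp_all [bitOne]
  have hbit2 : ∀ a j t, bitTwo (if β j t then 2 else if S (β j) a t then 1 else 0) = β j t := by
    intro a j t
    cases h1 : β j t <;> cases h2 : S (β j) a t <;> simp [bitTwo]
  refine ⟨k, M1, M2, fun a j t => if β j t then 2 else if S (β j) a t then 1 else 0, hk1, hM12,
    hM22, ?_, ?_, ?_⟩
  · intro a b a' b' h
    simp only [hbit1] at h
    rw [← hS2 (β b) (hβ b) a, ← hS2 (β b') (hβ b') a', funext h]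
  · intro a b a' b' h
    simp only [hbit2] at h
    exact B.equivFin.symm.injective (Subtype.ext (funext h))
  · have hM1pos : (0 : ℝ) < M1 := by exact_mod_cast (by omega : 0 < M1)
    have hM2pos' : (0 : ℝ) < M2 := by exact_mod_cast hM2pos
    have h1 : 3 ^ k ≤ 4 * k * (k + 1) * (M1 * M2) := by
      calc 3 ^ k ≤ (k + 1) * (M2 * N) := hw
        _ ≤ (k + 1) * (M2 * (4 * k * M1)) := by gcongr
        _ = 4 * k * (k + 1) * (M1 * M2) := by ring
    have h2 : (3 : ℝ) ^ k ≤ Real.exp δ ^ k * (M1 * M2) := by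
      have : (3 : ℝ) ^ k ≤ 4 * k * (k + 1) * (M1 * M2) := by exact_mod_cast h1
      exact this.trans (by gcongr)
    have h3 := Real.log_le_log (by positivity) h2
    rw [Real.log_pow, Real.log_mul (by positivity) (by positivity), Real.log_pow, Real.log_exp,
      Real.log_mul hM1pos.ne' hM2pos'.ne'] at h3
    linarith

lemma card_hamming_ball_le {A : Type*} [Fintype A] [DecidableEq A] {L : ℕ} (c : Fin L → A) (D : ℕ)
    {ξ : ℝ} (h0 : 0 < ξ) (h1 : ξ ≤ 1) :
    ((Finset.univ.filter fun x : Fin L → A => hammingDist c x ≤ D).card : ℝ) * ξ ^ D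
      ≤ (1 + Fintype.card A * ξ) ^ L := by
  have hpow : ∀ x : Fin L → A, ξ ^ hammingDist c x = ∏ i, if c i ≠ x i then ξ else 1 := by
    intro x
    rw [hammingDist, ← Finset.prod_const, Finset.prod_filter]
  calc ((Finset.univ.filter fun x : Fin L → A => hammingDist c x ≤ D).card : ℝ) * ξ ^ D
      = ∑ x : Fin L → A with hammingDist c x ≤ D, ξ ^ D := by
        rw [Finset.sum_const, nsmul_eq_mul]
    _ ≤ ∑ x : Fin L → A with hammingDist c x ≤ D, ξ ^ hammingDist c x :=
        Finset.sum_le_sum fun x hx =>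
          pow_le_pow_of_le_one h0.le h1 (Finset.mem_filter.1 hx).2
    _ ≤ ∑ x : Fin L → A, ξ ^ hammingDist c x :=
        Finset.sum_le_sum_of_subset_of_nonneg (Finset.filter_subset _ _)
          fun _ _ _ => (pow_pos h0 _).le
    _ = ∏ i : Fin L, ∑ a : A, if c i ≠ a then ξ else 1 := by
        have := Finset.prod_univ_sum (fun _ : Fin L => (Finset.univ : Finset A))
          fun i a => if c i ≠ a then ξ else 1
        rw [Fintype.piFinset_univ] at this
        rw [this]
        exact Finset.sum_congr rfl fun x _ => hpow x
    _ ≤ ∏ _i : Fin L, (1 + Fintype.card A * ξ) := by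
        refine Finset.prod_le_prod (fun i _ => Finset.sum_nonneg fun a _ => by
          split_ifs <;> linarith) fun i _ => ?_
        have : ∀ a, (if c i ≠ a then ξ else 1) ≤ ξ + if c i = a then 1 else 0 := by
          intro a; by_cases h : c i = a <;> simp [h, h0.le]
        refine (Finset.sum_le_sum fun a _ => this a).trans (le_of_eq ?_)
        rw [Finset.sum_add_distrib, Finset.sum_const, Finset.card_univ, nsmul_eq_mul]
        simp [add_comm]
    _ = (1 + Fintype.card A * ξ) ^ L := by simp

/-- The Gilbert–Varshamov bound. -/
lemma exists_separated_code (A : Type*) [Fintype A] [DecidableEq A] (L D : ℕ)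
    {ξ : ℝ} (h0 : 0 < ξ) (h1 : ξ ≤ 1) :
    ∃ S : Finset (Fin L → A), (∀ x ∈ S, ∀ y ∈ S, x ≠ y → D < hammingDist x y) ∧
      (Fintype.card A : ℝ) ^ L * ξ ^ D ≤ S.card * (1 + Fintype.card A * ξ) ^ L := by
  obtain ⟨S, hS, hmax⟩ := Finset.exists_max_image
    (Finset.univ.filter fun S : Finset (Fin L → A) =>
      ∀ x ∈ S, ∀ y ∈ S, x ≠ y → D < hammingDist x y) Finset.card ⟨∅, by simp⟩
  have hS' := (Finset.mem_filter.1 hS).2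
  refine ⟨S, hS', ?_⟩
  have hcov : ∀ x, ∃ c ∈ S, hammingDist c x ≤ D := by
    intro x
    by_contra! hx
    have hxS : x ∉ S := fun h => by
      have := hx x h
      simp at this
    have hins : insert x S ∈ Finset.univ.filter fun S : Finset (Fin L → A) =>
        ∀ x ∈ S, ∀ y ∈ S, x ≠ y → D < hammingDist x y := by
      refine Finset.mem_filter.2 ⟨Finset.mem_univ _, ?_⟩
      intro u hu v hv huv
      rcases Finset.mem_insert.1 hu with hu' | hu' <;> rcases Finset.mem_insert.1 hv with hv' | hv'
      · exact absurd (hu'.trans hv'.symm) huv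
      · rw [hu', hammingDist_comm]; exact hx v hv'
      · rw [hv']; exact hx u hu'
      · exact hS' u hu' v hv' huv
    have := hmax _ hins
    rw [Finset.card_insert_of_notMem hxS] at this
    omega
  have hsub : (Finset.univ : Finset (Fin L → A)) ⊆
      S.biUnion fun c => Finset.univ.filter fun x => hammingDist c x ≤ D := by
    intro x _
    obtain ⟨c, hc, hcx⟩ := hcov x
    exact Finset.mem_biUnion.2 ⟨c, hc, by simpa using hcx⟩
  have hcard := (Finset.card_le_card hsub).trans Finset.card_biUnion_le
  rw [Finset.card_univ, Fintype.card_fun, Fintype.card_fin] at hcard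
  have hcard' : (Fintype.card A : ℝ) ^ L ≤ ∑ c ∈ S,
      ((Finset.univ.filter fun x : Fin L → A => hammingDist c x ≤ D).card : ℝ) := by
    exact_mod_cast hcard
  calc (Fintype.card A : ℝ) ^ L * ξ ^ D
      ≤ (∑ c ∈ S, ((Finset.univ.filter fun x : Fin L → A => hammingDist c x ≤ D).card : ℝ)) * ξ ^ D :=
        mul_le_mul_of_nonneg_right hcard' (pow_pos h0 _).le
    _ ≤ ∑ _c ∈ S, (1 + Fintype.card A * ξ) ^ L := by
        rw [Finset.sum_mul]
        exact Finset.sum_le_sum fun c _ => card_hamming_ball_le c D h0 h1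
    _ = S.card * (1 + Fintype.card A * ξ) ^ L := by rw [Finset.sum_const, nsmul_eq_mul]

/-- The number of words of small weight on a given set of positions. -/
lemma card_low_weight {n : ℕ} (T : Finset (Fin n)) (κ : Fin n → Bool) (F : Finset Bool)
    {ρ : ℝ} (h0 : 0 < ρ) (h1 : ρ < 1 / 2) :
    ((Finset.univ.filter fun u : Fin n → Bool => (∀ t, t ∉ T → u t ∈ F) ∧
        ((T.filter fun t => Bool.xor (u t) (κ t) = true).card : ℝ) ≤ ρ * T.card).card : ℝ)
      ≤ (F.card : ℝ) ^ (n - T.card) * Real.exp (T.card * Real.binEntropy ρ) := by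
  set g : Fin n → Bool → ℝ := fun t b => if t ∈ T then (if Bool.xor b (κ t) then ρ else 1 - ρ)
    else if b ∈ F then 1 else 0 with hg
  have hg0 : ∀ t b, 0 ≤ g t b := by
    intro t b; simp only [hg]; split_ifs <;> linarith
  have hρ1 : 0 < 1 - ρ := by linarith
  have hlow : ∀ u ∈ (Finset.univ.filter fun u : Fin n → Bool => (∀ t, t ∉ T → u t ∈ F) ∧
      ((T.filter fun t => Bool.xor (u t) (κ t) = true).card : ℝ) ≤ ρ * T.card),
      Real.exp (-(T.card * Real.binEntropy ρ)) ≤ ∏ t, g t (u t) := by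
    intro u hu
    obtain ⟨-, hF, hw⟩ := Finset.mem_filter.1 hu
    have e1 : ∏ t, g t (u t) = ∏ t ∈ T, if Bool.xor (u t) (κ t) then ρ else 1 - ρ := by
      rw [← Finset.prod_mul_prod_compl T]
      have : ∏ t ∈ Tᶜ, g t (u t) = 1 := by
        refine Finset.prod_eq_one fun t ht => ?_
        have ht' := Finset.mem_compl.1 ht
        simp [hg, ht', hF t ht']
      rw [this, mul_one]
      exact Finset.prod_congr rfl fun t ht => by simp [hg, ht]
    have e2 : ∏ t ∈ T, (if Bool.xor (u t) (κ t) then ρ else 1 - ρ)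
        = ∏ t ∈ T, Real.exp ((if Bool.xor (u t) (κ t) then Real.log ρ - Real.log (1 - ρ) else 0)
          + Real.log (1 - ρ)) := by
      refine Finset.prod_congr rfl fun t _ => ?_
      split_ifs
      · rw [sub_add_cancel, Real.exp_log h0]
      · rw [zero_add, Real.exp_log hρ1]
    rw [e1, e2, ← Real.exp_sum, Real.exp_le_exp, Finset.sum_add_distrib, ← Finset.sum_filter,
      Finset.sum_const, Finset.sum_const, nsmul_eq_mul, nsmul_eq_mul,
      Real.binEntropy_eq_negMulLog_add_negMulLog_one_sub, Real.negMulLog, Real.negMulLog]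
    have hlog : Real.log ρ - Real.log (1 - ρ) ≤ 0 :=
      sub_nonpos.2 (Real.log_le_log h0 (by linarith))
    have := mul_le_mul_of_nonpos_right hw hlog
    linarith
  have hsum : ∑ u : Fin n → Bool, ∏ t, g t (u t) = (F.card : ℝ) ^ (n - T.card) := by
    have := (Finset.prod_univ_sum (fun _ : Fin n => (Finset.univ : Finset Bool)) g).symm
    rw [Fintype.piFinset_univ] at this
    rw [this, ← Finset.prod_mul_prod_compl T]
    have e1 : ∏ t ∈ T, ∑ b, g t b = 1 := by
      refine Finset.prod_eq_one fun t ht => ?_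
      simp only [hg, if_pos ht]
      cases κ t <;> simp
    have e2 : ∏ t ∈ Tᶜ, ∑ b, g t b = ∏ t ∈ Tᶜ, (F.card : ℝ) := by
      refine Finset.prod_congr rfl fun t ht => ?_
      simp only [hg, if_neg (Finset.mem_compl.1 ht), Finset.sum_ite_mem, Finset.univ_inter,
        Finset.sum_const, nsmul_eq_mul, mul_one]
    rw [e1, e2, one_mul, Finset.prod_const, Finset.card_compl, Fintype.card_fin]
  have h := (Finset.sum_le_sum hlow).trans
    (Finset.sum_le_sum_of_subset_of_nonneg (Finset.filter_subset _ _)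
      fun u _ _ => Finset.prod_nonneg fun t _ => hg0 t (u t))
  rw [hsum, Finset.sum_const, nsmul_eq_mul, Real.exp_neg, ← div_eq_mul_inv,
    div_le_iff₀ (Real.exp_pos _)] at h
  exact h

/-- A Chernoff bound for the number of occurrences of a letter class on a set of positions. -/
lemma chernoff {Λ : Type*} [Fintype Λ] {P : Λ → ℝ} (hP : ∀ v, 0 ≤ P v) (hP1 : ∑ v, P v = 1)
    (f : Λ → Bool) {a η : ℝ} (ha : ∑ v, (if f v then P v else 0) ≤ a) (ha1 : a ≤ 1) (hη : 0 < η)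
    (hη2 : η ≤ 2) {n : ℕ} (T : Finset (Fin n)) :
    ∑ ν : Fin n → Λ, (∏ t, P (ν t)) *
        (if (a + η) * T.card < ((T.filter fun t => f (ν t) = true).card : ℝ) then 1 else 0)
      ≤ Real.exp (-(T.card * (η ^ 2 / 4))) := by
  set s : ℝ := η / 2 with hs
  have hs0 : 0 < s := by positivity
  have hs1 : s ≤ 1 := by linarith
  set g : Fin n → Λ → ℝ := fun t v => P v * (if t ∈ T then (if f v then Real.exp s else 1) else 1)
    with hg
  have hpt : ∀ ν : Fin n → Λ, (∏ t, P (ν t)) *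
      (if (a + η) * T.card < ((T.filter fun t => f (ν t) = true).card : ℝ) then 1 else 0)
      ≤ Real.exp (-(s * ((a + η) * T.card))) * ∏ t, g t (ν t) := by
    intro ν
    have e : ∏ t, g t (ν t) = (∏ t, P (ν t)) *
        Real.exp (s * (T.filter fun t => f (ν t) = true).card) := by
      simp only [hg]
      rw [Finset.prod_mul_distrib, Finset.prod_ite_mem, Finset.univ_inter, ← Finset.prod_filter,
        Finset.prod_const, ← Real.exp_nat_mul, mul_comm s]
    rw [e, mul_left_comm, ← Real.exp_add]
    refine mul_le_mul_of_nonneg_left ?_ (Finset.prod_nonneg fun t _ => hP _)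
    split_ifs with h
    · refine Real.one_le_exp ?_
      nlinarith
    · exact (Real.exp_pos _).le
  have hsum : ∑ ν : Fin n → Λ, ∏ t, g t (ν t) ≤ Real.exp (T.card * (a * (s + s ^ 2))) := by
    have := (Finset.prod_univ_sum (fun _ : Fin n => (Finset.univ : Finset Λ)) g).symm
    rw [Fintype.piFinset_univ] at this
    rw [this, ← Finset.prod_mul_prod_compl T]
    have e2 : ∏ t ∈ Tᶜ, ∑ b, g t b = 1 := by
      refine Finset.prod_eq_one fun t ht => ?_
      simp only [hg, if_neg (Finset.mem_compl.1 ht), mul_one, hP1]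
    have hexp : Real.exp s ≤ 1 + s + s ^ 2 := by
      have := Real.abs_exp_sub_one_sub_id_le (x := s) (by rw [abs_of_pos hs0]; exact hs1)
      have := (abs_le.1 this).2
      linarith
    have e1 : ∏ t ∈ T, ∑ b, g t b ≤ ∏ t ∈ T, Real.exp (a * (s + s ^ 2)) := by
      refine Finset.prod_le_prod (fun t _ => Finset.sum_nonneg fun b _ => mul_nonneg (hP b) ?_)
        fun t ht => ?_
      · split_ifs <;> positivity
      · have e : ∑ b, g t b = 1 + (∑ v, if f v then P v else 0) * (Real.exp s - 1) := by
          have e0 : ∀ b, g t b = P b + (if f b then P b else 0) * (Real.exp s - 1) := by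
            intro b
            simp only [hg, if_pos ht]
            split_ifs <;> ring
          rw [Finset.sum_congr rfl fun b _ => e0 b, Finset.sum_add_distrib, ← Finset.sum_mul, hP1]
        have hq0 : 0 ≤ ∑ v, if f v then P v else 0 :=
          Finset.sum_nonneg fun v _ => by split_ifs; exacts [hP v, le_rfl]
        have h2 : (∑ v, if f v then P v else 0) * (Real.exp s - 1) ≤ a * (s + s ^ 2) :=
          mul_le_mul ha (by linarith) (by linarith [Real.add_one_le_exp s]) (hq0.trans ha)
        have := Real.add_one_le_exp (a * (s + s ^ 2))
        rw [e]; linarith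
    rw [e2, mul_one]
    refine e1.trans (le_of_eq ?_)
    rw [Finset.prod_const, ← Real.exp_nat_mul]
  have hT : (0 : ℝ) ≤ T.card := Nat.cast_nonneg _
  calc _ ≤ ∑ ν : Fin n → Λ, Real.exp (-(s * ((a + η) * T.card))) * ∏ t, g t (ν t) :=
        Finset.sum_le_sum fun ν _ => hpt ν
    _ ≤ Real.exp (-(s * ((a + η) * T.card))) * Real.exp (T.card * (a * (s + s ^ 2))) := by
        rw [← Finset.mul_sum]
        exact mul_le_mul_of_nonneg_left hsum (Real.exp_pos _).le
    _ ≤ Real.exp (-(T.card * (η ^ 2 / 4))) := by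
        rw [← Real.exp_add, Real.exp_le_exp]
        have e : -(s * ((a + η) * T.card)) + T.card * (a * (s + s ^ 2))
            = T.card * (a * s ^ 2 - s * η) := by ring
        have h2 : a * s ^ 2 ≤ s ^ 2 := by nlinarith [sq_nonneg s]
        have h3 : a * s ^ 2 - s * η ≤ -(η ^ 2 / 4) := by rw [hs] at *; nlinarith
        rw [e]
        nlinarith

/-- Counting functions through the values at two distinct points. -/
lemma card_fun_pair_le {Z U : Type*} [Fintype Z] [DecidableEq Z] [Fintype U] {a b : Z}
    (hab : a ≠ b) (S : U → U → Prop) {V : ℝ}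
    (hV : ∀ w, ((Finset.univ.filter fun u => S u w).card : ℝ) ≤ V) :
    ((Finset.univ.filter fun c : Z → U => S (c a) (c b)).card : ℝ) * Fintype.card U
      ≤ Fintype.card (Z → U) * V := by
  have e1 : ((Finset.univ.filter fun c : Z → U => S (c a) (c b)).card : ℝ)
      = ∑ r : {j // j ≠ a} → U, ((Finset.univ.filter fun u => S u (r ⟨b, hab.symm⟩)).card : ℝ) := by
    rw [Finset.natCast_card_filter, ← (Equiv.funSplitAt a U).symm.sum_comp, Fintype.sum_prod_type_right]
    refine Finset.sum_congr rfl fun r _ => ?_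
    rw [Finset.natCast_card_filter]
    refine Finset.sum_congr rfl fun u _ => ?_
    simp [Equiv.funSplitAt, Equiv.piSplitAt, hab.symm]
  have e2 : (Fintype.card (Z → U) : ℝ)
      = Fintype.card U * Fintype.card ({j // j ≠ a} → U) := by
    rw [Fintype.card_congr (Equiv.funSplitAt a U), Fintype.card_prod]; push_cast; rfl
  rw [e1, e2]
  have h : ∑ r : {j // j ≠ a} → U, ((Finset.univ.filter fun u => S u (r ⟨b, hab.symm⟩)).card : ℝ)
      ≤ ∑ _r : {j // j ≠ a} → U, V := Finset.sum_le_sum fun r _ => hV _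
  rw [Finset.sum_const, Finset.card_univ, nsmul_eq_mul] at h
  have := mul_le_mul_of_nonneg_right h (Nat.cast_nonneg (α := ℝ) (Fintype.card U))
  linarith

/-- The law of the noise variables `(Z, Z, (W₁, W₂))`. -/
def noiseLaw (p : ℝ) (Q : Bool × Bool → ℝ) (v : Bool × Bool × (Bool × Bool)) : ℝ :=
  if v.1 = v.2.1 then bsc p false v.1 * Q v.2.2 else 0

/-- The noise variables that turn the input `x` into the output `y`. -/
def noiseOf (x : Fin 3) (y : Bool × Bool × (Bool × Bool)) : Bool × Bool × (Bool × Bool) :=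
  (Bool.xor y.1 (bitOne x), Bool.xor y.2.1 (bitTwo x),
    (Bool.xor y.2.2.1 y.1, Bool.xor y.2.2.2 y.2.1))

lemma noiseOf_injective (x : Fin 3) : Function.Injective (noiseOf x) := by
  rintro ⟨a, b, c, d⟩ ⟨a', b', c', d'⟩ h
  simp only [noiseOf, Prod.mk.injEq] at h
  obtain ⟨h1, h2, h3, h4⟩ := h
  have ha : a = a' := Bool.xor_left_inj.1 h1
  have hb : b = b' := Bool.xor_left_inj.1 h2
  subst ha hb
  rw [Bool.xor_left_inj.1 h3, Bool.xor_left_inj.1 h4]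

lemma blackwellNoisyW_eq_noiseLaw (p : ℝ) (Q : Bool × Bool → ℝ) (x : Fin 3)
    (y : Bool × Bool × (Bool × Bool)) :
    blackwellNoisyW p Q x y = noiseLaw p Q (noiseOf x y) := by
  obtain ⟨a, b, c, d⟩ := y
  rw [blackwellNoisyW, noiseLaw, noiseOf]
  have : blackwellW p x (a, b)
      = if Bool.xor a (bitOne x) = Bool.xor b (bitTwo x) then bsc p false (Bool.xor a (bitOne x))
        else 0 := by
    simp only [blackwellW, bsc, bitOne, bitTwo, Fintype.sum_bool]
    cases a <;> cases b <;> fin_cases x <;> simp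
  simp only [this]
  split_ifs <;> simp

lemma noiseLaw_nonneg {p : ℝ} (hp0 : 0 < p) (hp : p < 1 / 2) {Q : Bool × Bool → ℝ} (hQ : IsPMF Q)
    (v : Bool × Bool × (Bool × Bool)) : 0 ≤ noiseLaw p Q v := by
  rw [noiseLaw]
  split_ifs
  · refine mul_nonneg ?_ (hQ.1 _)
    rw [bsc]; split_ifs <;> linarith
  · exact le_rfl

lemma sum_noiseLaw_mul (p : ℝ) (Q : Bool × Bool → ℝ) (f : Bool × Bool × (Bool × Bool) → ℝ) :
    ∑ v, noiseLaw p Q v * f v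
      = p * ∑ w, Q w * f (true, true, w) + (1 - p) * ∑ w, Q w * f (false, false, w) := by
  simp only [Fintype.sum_prod_type, Fintype.sum_bool, noiseLaw, bsc]
  simp
  ring

/-- With causal feedback encoding, the channel outputs and the channel noise determine each
other. -/
lemma sum_outputs_eq_sum_noise (p : ℝ) (Q : Bool × Bool → ℝ) {n : ℕ}
    (enc : Fin n → (Fin n → Bool × Bool) → Fin 3)
    (hc : ∀ (t : Fin n) fb fb', (∀ s : Fin n, (s : ℕ) < (t : ℕ) → fb s = fb' s) → enc t fb = enc t fb')
    (G : (Fin n → Bool × Bool × (Bool × Bool)) → ℝ) :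
    ∑ y : Fin n → Bool × Bool × (Bool × Bool),
        (∏ t, blackwellNoisyW p Q (enc t fun s => (y s).2.2) (y t)) *
          G (fun t => noiseOf (enc t fun s => (y s).2.2) (y t))
      = ∑ ν : Fin n → Bool × Bool × (Bool × Bool), (∏ t, noiseLaw p Q (ν t)) * G ν := by
  have hinj : Function.Injective fun (y : Fin n → Bool × Bool × (Bool × Bool)) (t : Fin n) =>
      noiseOf (enc t fun s => (y s).2.2) (y t) := by
    intro y y' h
    have key : ∀ k : ℕ, ∀ t : Fin n, (t : ℕ) = k → y t = y' t := by
      intro k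
      induction k using Nat.strong_induction_on with
      | _ k ih =>
        intro t ht
        have he : (enc t fun s => (y s).2.2) = enc t fun s => (y' s).2.2 :=
          hc t _ _ fun s hs => by simp only [ih s (ht ▸ hs) s rfl]
        have := congrFun h t
        simp only [he] at this
        exact noiseOf_injective _ this
    exact funext fun t => key t t rfl
  refine Fintype.sum_bijective _ (Finite.injective_iff_bijective.1 hinj) _ _ fun y => ?_
  simp only [blackwellNoisyW_eq_noiseLaw]

/-- The word `u` has relative weight at most `θ` on the positions `T`. -/
def LowWeight {n : ℕ} (T : Finset (Fin n)) (θ : ℝ) (u : Fin n → Bool) : Prop :=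
  ((T.filter fun t => u t = true).card : ℝ) ≤ θ * T.card

lemma LowWeight.congr {n : ℕ} {T : Finset (Fin n)} {θ : ℝ} {u v : Fin n → Bool}
    (h : LowWeight T θ u) (huv : ∀ t ∈ T, u t = v t) : LowWeight T θ v := by
  rw [LowWeight, Finset.filter_congr fun t ht => by rw [← huv t ht]]
  exact h

/-- Consistency of the received word `y` with the noise `z` and the transmitted bits `S` on the
positions `T` and with the description `c z` of the noise elsewhere. -/
def Consistent {n : ℕ} (T : Finset (Fin n)) (ρ η : ℝ) (c : (Fin n → Bool) → Fin n → Bool)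
    (S y z : Fin n → Bool) : Prop :=
  (∀ t, t ∉ T → z t = false) ∧ LowWeight T ρ z ∧
    LowWeight Tᶜ ρ (fun t => Bool.xor (c z t) (y t)) ∧
    LowWeight T η (fun t => Bool.xor (Bool.xor (y t) (z t)) (S t))

/-- Some other likely noise word `z'` has a description compatible with that of `z`. -/
def Confusable {n : ℕ} (T : Finset (Fin n)) (ρ : ℝ) (c : (Fin n → Bool) → Fin n → Bool)
    (e z : Fin n → Bool) : Prop :=
  ∃ z', (∀ t, t ∉ T → z' t = false) ∧ LowWeight T ρ z' ∧ z' ≠ z ∧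
    LowWeight Tᶜ ρ (fun t => Bool.xor (c z' t) (Bool.xor (c z t) (e t)))

section Receiver

variable {n : ℕ} {T : Finset (Fin n)} {ρ η : ℝ} {c : (Fin n → Bool) → Fin n → Bool}
  {S y z e : Fin n → Bool}

lemma consistent_of_typical (hy : ∀ t, y t = Bool.xor (e t) (if t ∈ T then S t else c z t))
    (hz : ∀ t, t ∉ T → z t = false) (h1 : LowWeight T ρ z)
    (h2 : LowWeight T η (fun t => Bool.xor (e t) (z t))) (h3 : LowWeight Tᶜ ρ e) :
    Consistent T ρ η c S y z := by
  refine ⟨hz, h1, h3.congr fun t ht => ?_, h2.congr fun t ht => ?_⟩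
  · rw [hy, if_neg (Finset.mem_compl.1 ht)]
    cases c z t <;> simp
  · rw [hy, if_pos ht]
    cases S t <;> simp

lemma card_ne_le_of_consistent
    (hy : ∀ t, y t = Bool.xor (e t) (if t ∈ T then S t else c z t))
    (h2 : LowWeight T η (fun t => Bool.xor (e t) (z t))) (h4 : ¬ Confusable T ρ c e z)
    {S' z' : Fin n → Bool} (h : Consistent T ρ η c S' y z') :
    ((T.filter fun t => S t ≠ S' t).card : ℝ) ≤ 2 * η * T.card := by
  obtain ⟨hz', hw', hc, hS⟩ := h
  have hzz : z' = z := by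
    by_contra hne
    refine h4 ⟨z', hz', hw', hne, hc.congr fun t ht => ?_⟩
    rw [hy, if_neg (Finset.mem_compl.1 ht), Bool.xor_comm (e t)]
  subst hzz
  have hsub : (T.filter fun t => S t ≠ S' t) ⊆
      (T.filter fun t => Bool.xor (e t) (z' t) = true) ∪
        T.filter fun t => Bool.xor (Bool.xor (y t) (z' t)) (S' t) = true := by
    intro t ht
    obtain ⟨htT, hne⟩ := Finset.mem_filter.1 ht
    rw [Finset.mem_union, Finset.mem_filter, Finset.mem_filter, hy, if_pos htT]
    revert hne
    simp only [htT, true_and]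
    cases S t <;> cases S' t <;> cases e t <;> cases z' t <;> simp
  have hle : ((T.filter fun t => S t ≠ S' t).card : ℝ)
      ≤ (T.filter fun t => Bool.xor (e t) (z' t) = true).card
        + (T.filter fun t => Bool.xor (Bool.xor (y t) (z' t)) (S' t) = true).card := by
    exact_mod_cast (Finset.card_le_card hsub).trans (Finset.card_union_le _ _)
  rw [LowWeight] at h2 hS
  linarith

end Receiver

/-- Random descriptions are rarely confusable. -/
lemma card_confusable_le {n : ℕ} (T : Finset (Fin n)) {ρ : ℝ} (h0 : 0 < ρ) (h1 : ρ < 1 / 2)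
    (e z : Fin n → Bool) :
    ((Finset.univ.filter fun c : (Fin n → Bool) → Fin n → Bool => Confusable T ρ c e z).card : ℝ)
      ≤ Fintype.card ((Fin n → Bool) → Fin n → Bool) *
        Real.exp (n * Real.binEntropy ρ - Tᶜ.card * Real.log 2) := by
  have hTle : T.card ≤ n := by simpa using Finset.card_le_univ T
  have hTc : Tᶜ.card = n - T.card := by rw [Finset.card_compl, Fintype.card_fin]
  set B : Finset (Fin n → Bool) := Finset.univ.filter fun u => (∀ t, t ∉ T → u t = false) ∧
    LowWeight T ρ u with hB
  have hBcard : (B.card : ℝ) ≤ Real.exp (T.card * Real.binEntropy ρ) := by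
    have := card_low_weight T (fun _ => false) {false} h0 h1
    simp only [Finset.card_singleton, Nat.cast_one, one_pow, one_mul, Finset.mem_singleton,
      Bool.xor_false] at this
    simp only [hB, LowWeight]
    convert this using 2
    congr
  set V : ℝ := 2 ^ T.card * Real.exp (Tᶜ.card * Real.binEntropy ρ) with hV
  set N : ℝ := (Fintype.card ((Fin n → Bool) → Fin n → Bool) : ℝ) with hN
  have hone : ∀ z' ∈ B.erase z, ((Finset.univ.filter fun c : (Fin n → Bool) → Fin n → Bool =>
      LowWeight Tᶜ ρ (fun t => Bool.xor (c z' t) (Bool.xor (c z t) (e t)))).card : ℝ) * 2 ^ n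
        ≤ N * V := by
    intro z' hz'
    have := card_fun_pair_le (U := Fin n → Bool) (Finset.ne_of_mem_erase hz')
      (fun u w => LowWeight Tᶜ ρ (fun t => Bool.xor (u t) (Bool.xor (w t) (e t)))) (V := V) ?_
    · simpa [hN] using this
    · intro w
      have := card_low_weight Tᶜ (fun t => Bool.xor (w t) (e t)) Finset.univ h0 h1
      rw [hTc, Nat.sub_sub_self hTle] at this
      simpa [LowWeight, hV, hTc] using this
  have hsub : (Finset.univ.filter fun c : (Fin n → Bool) → Fin n → Bool => Confusable T ρ c e z)
      ⊆ (B.erase z).biUnion fun z' => Finset.univ.filter fun c =>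
        LowWeight Tᶜ ρ (fun t => Bool.xor (c z' t) (Bool.xor (c z t) (e t))) := by
    intro c hc
    obtain ⟨z', ha, hb, hd, hf⟩ := (Finset.mem_filter.1 hc).2
    exact Finset.mem_biUnion.2 ⟨z', Finset.mem_erase.2 ⟨hd, Finset.mem_filter.2
      ⟨Finset.mem_univ _, ha, hb⟩⟩, Finset.mem_filter.2 ⟨Finset.mem_univ _, hf⟩⟩
  have hcard : ((Finset.univ.filter fun c : (Fin n → Bool) → Fin n → Bool =>
      Confusable T ρ c e z).card : ℝ) ≤ ∑ z' ∈ B.erase z, ((Finset.univ.filter fun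
        c : (Fin n → Bool) → Fin n → Bool =>
      LowWeight Tᶜ ρ (fun t => Bool.xor (c z' t) (Bool.xor (c z t) (e t)))).card : ℝ) := by
    exact_mod_cast (Finset.card_le_card hsub).trans Finset.card_biUnion_le
  have h2n : (0 : ℝ) < 2 ^ n := by positivity
  have hNV : 0 ≤ N * V := by positivity
  have hmain : ((Finset.univ.filter fun c : (Fin n → Bool) → Fin n → Bool =>
      Confusable T ρ c e z).card : ℝ) * 2 ^ n
        ≤ Real.exp (T.card * Real.binEntropy ρ) * (N * V) := by
    calc _ ≤ (∑ z' ∈ B.erase z, ((Finset.univ.filter fun c : (Fin n → Bool) → Fin n → Bool =>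
          LowWeight Tᶜ ρ (fun t => Bool.xor (c z' t) (Bool.xor (c z t) (e t)))).card : ℝ))
            * 2 ^ n := mul_le_mul_of_nonneg_right hcard h2n.le
      _ ≤ ∑ _z' ∈ B.erase z, N * V := by
          rw [Finset.sum_mul]
          exact Finset.sum_le_sum hone
      _ ≤ B.card * (N * V) := by
          rw [Finset.sum_const, nsmul_eq_mul]
          exact mul_le_mul_of_nonneg_right
            (by exact_mod_cast Finset.card_le_card (Finset.erase_subset _ _)) hNV
      _ ≤ _ := mul_le_mul_of_nonneg_right hBcard hNV
  have hpow : ∀ m : ℕ, (2 : ℝ) ^ m = Real.exp (m * Real.log 2) := by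
    intro m; rw [Real.exp_nat_mul, Real.exp_log two_pos]
  have e1 : Real.exp (T.card * Real.binEntropy ρ) * (N * V)
      = N * Real.exp (n * Real.binEntropy ρ - Tᶜ.card * Real.log 2) * 2 ^ n := by
    have hn : (n : ℝ) = T.card + Tᶜ.card := by
      rw [hTc, Nat.cast_sub hTle]; ring
    rw [hV, hpow, hpow, mul_left_comm, ← Real.exp_add, ← Real.exp_add, mul_assoc N,
      ← Real.exp_add, hn]
    congr 2; ring
  rw [e1] at hmain
  exact le_of_mul_le_mul_right hmain h2n

lemma exists_good_description {Ω : Type*} [Fintype Ω] {w : Ω → ℝ} (hw : ∀ ω, 0 ≤ w ω)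
    (hw1 : ∑ ω, w ω = 1) {n : ℕ} (T : Finset (Fin n)) {ρ : ℝ} (h0 : 0 < ρ) (h1 : ρ < 1 / 2)
    (e e' z : Ω → Fin n → Bool) :
    ∃ c : (Fin n → Bool) → Fin n → Bool,
      ∑ ω, w ω * ((if Confusable T ρ c (e ω) (z ω) then 1 else 0)
          + if Confusable T ρ c (e' ω) (z ω) then 1 else 0)
        ≤ 2 * Real.exp (n * Real.binEntropy ρ - Tᶜ.card * Real.log 2) := by
  set X : ℝ := Real.exp (n * Real.binEntropy ρ - Tᶜ.card * Real.log 2) with hX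
  have hsum : ∑ c : (Fin n → Bool) → Fin n → Bool,
      ∑ ω, w ω * ((if Confusable T ρ c (e ω) (z ω) then 1 else 0)
          + if Confusable T ρ c (e' ω) (z ω) then 1 else 0)
      ≤ ∑ _c : (Fin n → Bool) → Fin n → Bool, 2 * X := by
    rw [Finset.sum_comm]
    calc _ ≤ ∑ ω, w ω * (Fintype.card ((Fin n → Bool) → Fin n → Bool) * (2 * X)) := by
          refine Finset.sum_le_sum fun ω _ => ?_
          rw [← Finset.mul_sum, Finset.sum_add_distrib, ← Finset.natCast_card_filter,
            ← Finset.natCast_card_filter]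
          refine mul_le_mul_of_nonneg_left ?_ (hw ω)
          have ha := card_confusable_le T h0 h1 (e ω) (z ω)
          have hb := card_confusable_le T h0 h1 (e' ω) (z ω)
          rw [← hX] at ha hb
          linarith
      _ = _ := by
          rw [← Finset.sum_mul, hw1, one_mul, Finset.sum_const, nsmul_eq_mul, Finset.card_univ]
  obtain ⟨c, -, hc⟩ := Finset.exists_le_of_sum_le Finset.univ_nonempty hsum
  exact ⟨c, hc⟩

lemma noiseLaw_isPMF {p : ℝ} (hp0 : 0 < p) (hp : p < 1 / 2) {Q : Bool × Bool → ℝ}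
    (hQ : IsPMF Q) : IsPMF (noiseLaw p Q) := by
  refine ⟨noiseLaw_nonneg hp0 hp hQ, ?_⟩
  have := sum_noiseLaw_mul p Q fun _ => 1
  simp only [mul_one, hQ.2] at this
  linarith

lemma sum_prod_pmf {Λ : Type*} [Fintype Λ] {P : Λ → ℝ} (hP1 : ∑ v, P v = 1) (n : ℕ) :
    ∑ ν : Fin n → Λ, ∏ t, P (ν t) = 1 := by
  have h := (Finset.prod_univ_sum (fun _ : Fin n => (Finset.univ : Finset Λ))
    fun _ v => P v).symm
  rw [Fintype.piFinset_univ] at h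
  rw [h]
  simp [hP1]

/-- The noise seen through the feedback link of the first receiver on the positions `T`. -/
def maskedNoise {n : ℕ} (T : Finset (Fin n)) (ν : Fin n → Bool × Bool × (Bool × Bool)) :
    Fin n → Bool :=
  fun t => if t ∈ T then Bool.xor (ν t).1 (ν t).2.2.1 else false

/-- The noise seen by a receiver, in the coordinate `g`, can be resolved. -/
def GoodNoise {n : ℕ} (T : Finset (Fin n)) (ρ η : ℝ) (c : (Fin n → Bool) → Fin n → Bool)
    (e z : Fin n → Bool) : Prop :=
  LowWeight T η (fun t => Bool.xor (e t) (z t)) ∧ LowWeight Tᶜ ρ e ∧ ¬ Confusable T ρ c e z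

section

variable {p η : ℝ} {Q : Bool × Bool → ℝ}

lemma sum_noiseLaw_if (p : ℝ) (Q : Bool × Bool → ℝ) (f : Bool × Bool × (Bool × Bool) → Bool) :
    ∑ v, (if f v then noiseLaw p Q v else 0)
      = p * ∑ w, (if f (true, true, w) then Q w else 0)
        + (1 - p) * ∑ w, (if f (false, false, w) then Q w else 0) := by
  have := sum_noiseLaw_mul p Q fun v => if f v then 1 else 0
  simpa only [mul_ite, mul_one, mul_zero] using this

lemma weight_tail (hp0 : 0 < p) (hp : p < 1 / 2) (hQ : IsPMF Q) {a ρ η : ℝ} (hη : 0 < η)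
    (hη1 : η ≤ 1) (ha1 : a ≤ 1) (f : Bool × Bool × (Bool × Bool) → Bool)
    (ha : ∑ v, (if f v then noiseLaw p Q v else 0) ≤ a) (hρ : a + η / 2 ≤ ρ)
    {n : ℕ} (T : Finset (Fin n)) (u : (Fin n → Bool × Bool × (Bool × Bool)) → Fin n → Bool)
    (hu : ∀ ν, ∀ t ∈ T, u ν t = f (ν t)) :
    ∑ ν : Fin n → Bool × Bool × (Bool × Bool), (∏ t, noiseLaw p Q (ν t)) *
        (if LowWeight T ρ (u ν) then 0 else 1) ≤ Real.exp (-(T.card * (η ^ 2 / 16))) := by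
  have hP := noiseLaw_isPMF hp0 hp hQ
  have h := chernoff hP.1 hP.2 f ha ha1 (half_pos hη) (by linarith) T
  refine (Finset.sum_le_sum fun ν _ => ?_).trans (h.trans (le_of_eq (by ring_nf)))
  refine mul_le_mul_of_nonneg_left ?_ (Finset.prod_nonneg fun t _ => hP.1 _)
  have e : T.filter (fun t => u ν t = true) = T.filter fun t => f (ν t) = true :=
    Finset.filter_congr fun t ht => by rw [hu ν t ht]
  rw [LowWeight, e]
  have : (a + η / 2) * (T.card : ℝ) ≤ ρ * T.card :=
    mul_le_mul_of_nonneg_right hρ (Nat.cast_nonneg _)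
  split_ifs with h1 h2 h2
  · exact zero_le_one
  · exact le_rfl
  · exact le_rfl
  · exact absurd (not_le.1 h1) (not_lt.2 ((not_lt.1 h2).trans this))

lemma indicator_failure_le (q1 q2 q3 q4 q5 q6 q7 : Prop)
    {_ : Decidable (q1 ∧ (q2 ∧ q4 ∧ ¬ q6) ∧ q3 ∧ q5 ∧ ¬ q7)} :
    (if q1 ∧ (q2 ∧ q4 ∧ ¬ q6) ∧ q3 ∧ q5 ∧ ¬ q7 then (0 : ℝ) else 1)
      ≤ (if q1 then 0 else 1) + (if q2 then 0 else 1) + (if q3 then 0 else 1)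
        + (if q4 then 0 else 1) + (if q5 then 0 else 1)
        + ((if q6 then 1 else 0) + if q7 then 1 else 0) := by
  have nn : ∀ q : Prop, (0 : ℝ) ≤ if q then 0 else 1 := fun q => by split_ifs <;> norm_num
  have nn' : ∀ q : Prop, (0 : ℝ) ≤ if q then 1 else 0 := fun q => by split_ifs <;> norm_num
  by_cases h : q1 ∧ (q2 ∧ q4 ∧ ¬ q6) ∧ q3 ∧ q5 ∧ ¬ q7
  · rw [if_pos h]
    linarith [nn q1, nn q2, nn q3, nn q4, nn q5, nn' q6, nn' q7]
  · rw [if_neg h]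
    have : ¬ q1 ∨ ¬ q2 ∨ ¬ q3 ∨ ¬ q4 ∨ ¬ q5 ∨ q6 ∨ q7 := by tauto
    rcases this with g | g | g | g | g | g | g <;> simp only [g, if_true, if_false] <;>
      linarith [nn q1, nn q2, nn q3, nn q4, nn q5, nn' q6, nn' q7]

/-- There is a description of the fed-back noise for which typical noise can be resolved. -/
lemma exists_description (hp0 : 0 < p) (hQ : IsPMF Q) (hη : 0 < η)
    (hpη : p + η < 1 / 2) (hq : ∑ w, (if w.1 then Q w else 0) ≤ η / 2)
    {n : ℕ} (T : Finset (Fin n)) :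
    ∃ c : (Fin n → Bool) → Fin n → Bool,
      ∑ ν : Fin n → Bool × Bool × (Bool × Bool), (∏ t, noiseLaw p Q (ν t)) *
        (if LowWeight T (p + η) (maskedNoise T ν) ∧
            GoodNoise T (p + η) η c (fun t => (ν t).1) (maskedNoise T ν) ∧
            GoodNoise T (p + η) η c (fun t => (ν t).2.1) (maskedNoise T ν) then 0 else 1)
        ≤ 3 * Real.exp (-(T.card * (η ^ 2 / 16))) + 2 * Real.exp (-(Tᶜ.card * (η ^ 2 / 16)))
          + 2 * Real.exp (n * Real.binEntropy (p + η) - Tᶜ.card * Real.log 2) := by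
  have hp : p < 1 / 2 := by linarith
  have hP := noiseLaw_isPMF hp0 hp hQ
  have hw : ∀ ν : Fin n → Bool × Bool × (Bool × Bool), 0 ≤ ∏ t, noiseLaw p Q (ν t) :=
    fun ν => Finset.prod_nonneg fun t _ => hP.1 _
  obtain ⟨c, hc⟩ := exists_good_description hw (sum_prod_pmf hP.2 n) T
    (ρ := p + η) (by linarith) hpη (fun ν t => (ν t).1) (fun ν t => (ν t).2.1)
    (fun ν => maskedNoise T ν)
  refine ⟨c, ?_⟩
  have hQnn : ∀ w, 0 ≤ if w.1 then Q w else 0 := fun w => by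
    split_ifs; exacts [hQ.1 w, le_rfl]
  have hq0 : 0 ≤ ∑ w, (if w.1 then Q w else 0) := Finset.sum_nonneg fun w _ => hQnn w
  have hq1 : ∑ w, (if w.1 = false then Q w else 0) ≤ 1 := by
    rw [← hQ.2]
    exact Finset.sum_le_sum fun w _ => by split_ifs; exacts [le_rfl, hQ.1 w]
  have tz := weight_tail hp0 hp hQ hη (by linarith) (a := p + η / 2) (ρ := p + η) (by linarith)
    (fun v => Bool.xor v.1 v.2.2.1) (by
      rw [sum_noiseLaw_if]
      simp only [Bool.true_xor, Bool.false_xor, Bool.not_eq_true']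
      nlinarith) (by linarith) T (maskedNoise T) fun ν t ht => by simp [maskedNoise, ht]
  have t1 := weight_tail hp0 hp hQ hη (by linarith) (a := η / 2) (ρ := η) (by linarith)
    (fun v => v.2.2.1) (by
      rw [sum_noiseLaw_if]
      simp only
      linarith) (by linarith) T
    (fun ν t => Bool.xor (ν t).1 (maskedNoise T ν t)) fun ν t ht => by simp [maskedNoise, ht]
  have t2 := weight_tail hp0 hp hQ hη (by linarith) (a := η / 2) (ρ := η) (by linarith)
    (fun v => Bool.xor v.2.1 (Bool.xor v.1 v.2.2.1)) (by
      rw [sum_noiseLaw_if]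
      simp only [Bool.true_xor, Bool.false_xor, Bool.not_not]
      linarith) (by linarith) T
    (fun ν t => Bool.xor (ν t).2.1 (maskedNoise T ν t)) fun ν t ht => by simp [maskedNoise, ht]
  have t3 := weight_tail hp0 hp hQ hη (by linarith) (a := p + η / 2) (ρ := p + η) (by linarith)
    (fun v => v.1) (by
      rw [sum_noiseLaw_if]
      simp [hQ.2]
      linarith) (by linarith) Tᶜ (fun ν t => (ν t).1) fun ν t _ => rfl
  have t4 := weight_tail hp0 hp hQ hη (by linarith) (a := p + η / 2) (ρ := p + η) (by linarith)
    (fun v => v.2.1) (by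
      rw [sum_noiseLaw_if]
      simp [hQ.2]
      linarith) (by linarith) Tᶜ (fun ν t => (ν t).2.1) fun ν t _ => rfl
  have hpt : ∀ ν : Fin n → Bool × Bool × (Bool × Bool),
      (if LowWeight T (p + η) (maskedNoise T ν) ∧
            GoodNoise T (p + η) η c (fun t => (ν t).1) (maskedNoise T ν) ∧
            GoodNoise T (p + η) η c (fun t => (ν t).2.1) (maskedNoise T ν) then (0 : ℝ) else 1)
      ≤ (if LowWeight T (p + η) (maskedNoise T ν) then 0 else 1)
        + (if LowWeight T η (fun t => Bool.xor (ν t).1 (maskedNoise T ν t)) then 0 else 1)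
        + (if LowWeight T η (fun t => Bool.xor (ν t).2.1 (maskedNoise T ν t)) then 0 else 1)
        + (if LowWeight Tᶜ (p + η) (fun t => (ν t).1) then 0 else 1)
        + (if LowWeight Tᶜ (p + η) (fun t => (ν t).2.1) then 0 else 1)
        + ((if Confusable T (p + η) c (fun t => (ν t).1) (maskedNoise T ν) then 1 else 0)
          + if Confusable T (p + η) c (fun t => (ν t).2.1) (maskedNoise T ν) then 1 else 0) := by
    exact fun ν => indicator_failure_le _ _ _ _ _ _ _
  refine (Finset.sum_le_sum fun ν _ => mul_le_mul_of_nonneg_left (hpt ν) (hw ν)).trans ?_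
  simp only [mul_add, Finset.sum_add_distrib] at hc ⊢
  linarith

end

/-- Separated codewords can be decoded in typical noise. -/
lemma exists_decoder {n : ℕ} (T : Finset (Fin n)) (ρ η : ℝ) (c : (Fin n → Bool) → Fin n → Bool)
    {I O : Type*} [Nonempty I] (S : I → O → Fin n → Bool)
    (hS : ∀ i o i' o', i ≠ i' →
      2 * η * T.card < ((T.filter fun t => S i o t ≠ S i' o' t).card : ℝ)) :
    ∃ dec : (Fin n → Bool) → I, ∀ (i : I) (o : O) (e z y : Fin n → Bool),
      (∀ t, y t = Bool.xor (e t) (if t ∈ T then S i o t else c z t)) →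
      (∀ t, t ∉ T → z t = false) → LowWeight T ρ z → GoodNoise T ρ η c e z → dec y = i := by
  refine ⟨fun y => if h : ∃ i o z, Consistent T ρ η c (S i o) y z then h.choose
    else Classical.arbitrary I, fun i o e z y hy hz hw hg => ?_⟩
  have hex : ∃ i o z, Consistent T ρ η c (S i o) y z :=
    ⟨i, o, z, consistent_of_typical hy hz hw hg.1 hg.2.1⟩
  simp only [dif_pos hex]
  obtain ⟨o', z', h⟩ := hex.choose_spec
  by_contra hne
  exact absurd (card_ne_le_of_consistent hy hg.1 hg.2.2 h) (not_le.2 (hS i o _ o' (Ne.symm hne)))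

lemma bitOne_ite (b : Bool) : bitOne (if b = true then 2 else 0) = b := by
  cases b <;> rfl

lemma bitTwo_ite (b : Bool) : bitTwo (if b = true then 2 else 0) = b := by
  cases b <;> rfl

lemma msgCard_zero (n : ℕ) : msgCard n 0 = 1 := by simp [msgCard]

/-- The two-phase code of a fixed blocklength. -/
lemma exists_block_code {p η : ℝ} {Q : Bool × Bool → ℝ} (hp0 : 0 < p) (hQ : IsPMF Q) (hη : 0 < η)
    (hpη : p + η < 1 / 2) (hq : ∑ w, (if w.1 then Q w else 0) ≤ η / 2) (n N : ℕ) {R1 R2 : ℝ}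
    (hR1 : 0 ≤ R1) (hR2 : 0 ≤ R2) (T : Finset (Fin n)) (hT : ∀ t, t ∈ T ↔ (t : ℕ) < N)
    (x : Fin (msgCard n R1) → Fin (msgCard n R2) → Fin n → Fin 3)
    (h1 : ∀ i j i' j', i ≠ i' → 2 * η * T.card
      < ((T.filter fun t => bitOne (x i j t) ≠ bitOne (x i' j' t)).card : ℝ))
    (h2 : ∀ i j i' j', j ≠ j' → 2 * η * T.card
      < ((T.filter fun t => bitTwo (x i j t) ≠ bitTwo (x i' j' t)).card : ℝ)) :
    ∃ enc dec1 dec2, Causal n enc ∧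
      errProbFB (blackwellNoisyW p Q) n 0 R1 R2 enc dec1 dec2
        ≤ 3 * Real.exp (-(T.card * (η ^ 2 / 16))) + 2 * Real.exp (-(Tᶜ.card * (η ^ 2 / 16)))
          + 2 * Real.exp (n * Real.binEntropy (p + η) - Tᶜ.card * Real.log 2) := by
  have hM0 : 0 < msgCard n 0 := msgCard_pos le_rfl
  have hM1 : 0 < msgCard n R1 := msgCard_pos hR1
  have hM2 : 0 < msgCard n R2 := msgCard_pos hR2
  have hsub : Subsingleton (Fin (msgCard n 0)) := by rw [msgCard_zero]; infer_instance
  have hne1 : Nonempty (Fin (msgCard n R1)) := ⟨⟨0, hM1⟩⟩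
  have hne2 : Nonempty (Fin (msgCard n R2)) := ⟨⟨0, hM2⟩⟩
  have hp : p < 1 / 2 := by linarith
  obtain ⟨c, hc⟩ := exists_description hp0 hQ hη hpη hq T
  set B : ℝ := 3 * Real.exp (-(T.card * (η ^ 2 / 16))) + 2 * Real.exp (-(Tᶜ.card * (η ^ 2 / 16)))
          + 2 * Real.exp (n * Real.binEntropy (p + η) - Tᶜ.card * Real.log 2) with hB
  obtain ⟨dec1, hdec1⟩ := exists_decoder T (p + η) η c (fun i j t => bitOne (x i j t)) h1
  obtain ⟨dec2, hdec2⟩ := exists_decoder T (p + η) η c (fun j i t => bitTwo (x i j t))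
    (fun j i j' i' h => h2 i j i' j' h)
  set zt : Fin (msgCard n 0) × Fin (msgCard n R1) × Fin (msgCard n R2) → (Fin n → Bool × Bool) →
      Fin n → Bool := fun m fb s =>
    if s ∈ T then Bool.xor (fb s).1 (bitOne (x m.2.1 m.2.2 s)) else false with hzt
  set enc : Fin n → Fin (msgCard n 0) × Fin (msgCard n R1) × Fin (msgCard n R2) →
      (Fin n → Bool × Bool) → Fin 3 := fun t m fb =>
    if t ∈ T then x m.2.1 m.2.2 t else if c (zt m fb) t then 2 else 0 with henc
  have hcausal : Causal n enc := by
    intro t m fb fb' h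
    simp only [henc]
    by_cases ht : t ∈ T
    · rw [if_pos ht, if_pos ht]
    · have : zt m fb = zt m fb' := by
        funext s
        simp only [hzt]
        split_ifs with hs
        · rw [h s (by rw [hT] at hs ht; omega)]
        · rfl
      rw [this]
  refine ⟨enc, fun y => (⟨0, hM0⟩, dec1 y), fun y => (⟨0, hM0⟩, dec2 y), hcausal, ?_⟩
  have key : ∀ m, ∑ y : Fin n → Bool × Bool × (Bool × Bool),
        (∏ t, blackwellNoisyW p Q (enc t m fun s => (y s).2.2) (y t)) *
          (if ((⟨0, hM0⟩, dec1 fun t => (y t).1) : Fin (msgCard n 0) × Fin (msgCard n R1))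
              ≠ (m.1, m.2.1) ∨
              ((⟨0, hM0⟩, dec2 fun t => (y t).2.1) : Fin (msgCard n 0) × Fin (msgCard n R2))
              ≠ (m.1, m.2.2)
            then 1 else 0) ≤ B := by
    intro m
    refine le_trans ?_ ((sum_outputs_eq_sum_noise p Q (fun t fb => enc t m fb)
      (fun t fb fb' h => hcausal t m fb fb' h) (fun ν =>
        if LowWeight T (p + η) (maskedNoise T ν) ∧
            GoodNoise T (p + η) η c (fun t => (ν t).1) (maskedNoise T ν) ∧
            GoodNoise T (p + η) η c (fun t => (ν t).2.1) (maskedNoise T ν) then 0 else 1)).trans_le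
      hc)
    refine Finset.sum_le_sum fun y _ => mul_le_mul_of_nonneg_left ?_
      (Finset.prod_nonneg fun t _ => by
        rw [blackwellNoisyW_eq_noiseLaw]; exact noiseLaw_nonneg hp0 hp hQ _)
    set ν : Fin n → Bool × Bool × (Bool × Bool) :=
      fun t => noiseOf (enc t m fun s => (y s).2.2) (y t) with hν
    have hz : maskedNoise T ν = zt m fun s => (y s).2.2 := by
      funext t
      simp only [maskedNoise, hzt, hν, noiseOf]
      split_ifs with ht
      · simp only [henc, if_pos ht]
        cases (y t).1 <;> cases (y t).2.2.1 <;> simp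
      · rfl
    have hzm : ∀ t, t ∉ T → maskedNoise T ν t = false := fun t ht => by simp [maskedNoise, ht]
    have hy1 : ∀ t, (y t).1 = Bool.xor (ν t).1
        (if t ∈ T then bitOne (x m.2.1 m.2.2 t) else c (maskedNoise T ν) t) := by
      intro t
      rw [hz]
      simp only [hν, noiseOf, henc]
      by_cases ht : t ∈ T
      · simp only [if_pos ht, Bool.xor_assoc, Bool.xor_self, Bool.xor_false]
      · simp only [if_neg ht, bitOne_ite, Bool.xor_assoc, Bool.xor_self, Bool.xor_false]
    have hy2 : ∀ t, (y t).2.1 = Bool.xor (ν t).2.1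
        (if t ∈ T then bitTwo (x m.2.1 m.2.2 t) else c (maskedNoise T ν) t) := by
      intro t
      rw [hz]
      simp only [hν, noiseOf, henc]
      by_cases ht : t ∈ T
      · simp only [if_pos ht, Bool.xor_assoc, Bool.xor_self, Bool.xor_false]
      · simp only [if_neg ht, bitTwo_ite, Bool.xor_assoc, Bool.xor_self, Bool.xor_false]
    split_ifs with hbad hgood hgood
    · obtain ⟨hw, hg1, hg2⟩ := hgood
      have e1 := hdec1 m.2.1 m.2.2 _ _ _ hy1 hzm hw hg1
      have e2 := hdec2 m.2.2 m.2.1 _ _ _ hy2 hzm hw hg2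
      rcases hbad with hbad | hbad
      · exact absurd (Prod.ext (Subsingleton.elim _ _) e1) hbad
      · exact absurd (Prod.ext (Subsingleton.elim _ _) e2) hbad
    · exact le_rfl
    · exact le_rfl
    · exact zero_le_one
  rw [errProbFB]
  refine (mul_le_mul_of_nonneg_left (Finset.sum_le_sum fun m _ => key m)
    (by positivity)).trans (le_of_eq ?_)
  rw [Finset.sum_const, Finset.card_univ, nsmul_eq_mul, Fintype.card_prod, Fintype.card_prod,
    Fintype.card_fin, Fintype.card_fin, Fintype.card_fin]
  have a0 : (msgCard n 0 : ℝ) ≠ 0 := by positivity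
  have a1 : (msgCard n R1 : ℝ) ≠ 0 := by positivity
  have a2 : (msgCard n R2 : ℝ) ≠ 0 := by positivity
  push_cast
  field_simp

lemma hammingDist_le_card_block {A : Type*} [DecidableEq A] {n k L : ℕ} {T : Finset (Fin n)}
    (u v : Fin n → Bool) (a a' : Fin L → A)
    (h : ∀ l, a l ≠ a' l → ∃ t ∈ T, (t : ℕ) / k = l ∧ u t ≠ v t) :
    hammingDist a a' ≤ (T.filter fun t => u t ≠ v t).card := by
  rw [hammingDist, ← Finset.card_image_of_injective _ Fin.val_injective]
  refine (Finset.card_le_card (t := (T.filter fun t => u t ≠ v t).image fun t : Fin n => (t : ℕ) / k)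
    ?_).trans Finset.card_image_le
  intro l hl
  obtain ⟨l', hl', rfl⟩ := Finset.mem_image.1 hl
  obtain ⟨t, ht, htl, hne⟩ := h l' (Finset.mem_filter.1 hl').2
  exact Finset.mem_image.2 ⟨t, Finset.mem_filter.2 ⟨ht, hne⟩, htl⟩

/-- Codes of almost full rate that have positive relative distance. -/
lemma exists_outer_code {M : ℕ} (hM : 2 ≤ M) (k : ℕ) {τ : ℝ} (hτ : 0 < τ) :
    ∃ η₀ > 0, ∀ η, 0 < η → η ≤ η₀ → ∀ L : ℕ, ∃ S : Finset (Fin L → Fin M),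
      (∀ x ∈ S, ∀ y ∈ S, x ≠ y → 2 * η * (k * L) < (hammingDist x y : ℝ)) ∧
      Real.exp (L * ((1 - τ) * Real.log M)) ≤ S.card := by
  have hM2 : (2 : ℝ) ≤ M := by exact_mod_cast hM
  have hM0 : (0 : ℝ) < M := by linarith
  have hlM : 0 < Real.log M := Real.log_pos (by linarith)
  set ξ : ℝ := min 1 (τ * Real.log M / 2 / M) with hξ
  have hξ0 : 0 < ξ := lt_min one_pos (by positivity)
  have hξ1 : ξ ≤ 1 := min_le_left _ _
  have hMξ : M * ξ ≤ τ * Real.log M / 2 := by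
    have := (le_div_iff₀ hM0).1 (min_le_right 1 (τ * Real.log M / 2 / M))
    linarith
  have hlξ : Real.log ξ ≤ 0 := Real.log_nonpos hξ0.le hξ1
  have hden : 0 < 4 * k * (-Real.log ξ) + 1 := by
    have : (0 : ℝ) ≤ k := Nat.cast_nonneg _
    nlinarith
  refine ⟨τ * Real.log M / (4 * k * (-Real.log ξ) + 1), by positivity, fun η h0 h1 L => ?_⟩
  have hη := (le_div_iff₀ hden).1 h1
  obtain ⟨S, hS, hcard⟩ := exists_separated_code (Fin M) L ⌊2 * η * (k * L)⌋₊ hξ0 hξ1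
  refine ⟨S, fun x hx y hy hxy => (Nat.lt_floor_add_one _).trans_le ?_, ?_⟩
  · exact_mod_cast hS x hx y hy hxy
  · rw [Fintype.card_fin] at hcard
    have hpos : (0 : ℝ) < (1 + M * ξ) ^ L := by positivity
    rw [← div_le_iff₀ hpos] at hcard
    refine le_trans ?_ hcard
    rw [← Real.log_le_log_iff (Real.exp_pos _) (by positivity), Real.log_exp,
      Real.log_div (by positivity) hpos.ne', Real.log_mul (by positivity) (by positivity),
      Real.log_pow, Real.log_pow, Real.log_pow]
    have hfl : (⌊2 * η * (k * L)⌋₊ : ℝ) ≤ 2 * η * (k * L) := Nat.floor_le (by positivity)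
    have e1 := mul_le_mul_of_nonpos_right hfl hlξ
    have e2 : Real.log (1 + M * ξ) ≤ τ * Real.log M / 2 := by
      have := Real.log_le_sub_one_of_pos (show 0 < 1 + M * ξ by positivity)
      linarith
    have e3 : Real.log M - τ * Real.log M / 2 + 2 * η * k * Real.log ξ
        ≥ (1 - τ) * Real.log M := by linarith
    have hL : (0 : ℝ) ≤ L := Nat.cast_nonneg _
    have e4 := mul_le_mul_of_nonneg_left e3 hL
    have e5 := mul_le_mul_of_nonneg_left e2 hL
    linarith

/-- The concatenated two-phase code of a fixed blocklength. -/
lemma exists_concatenated_code {p η : ℝ} {Q : Bool × Bool → ℝ} (hp0 : 0 < p) (hQ : IsPMF Q)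
    (hη : 0 < η) (hpη : p + η < 1 / 2) (hq : ∑ w, (if w.1 then Q w else 0) ≤ η / 2)
    {n k L : ℕ} (hk : 1 ≤ k) (hn : k * L ≤ n) {R1 R2 : ℝ} (hR1 : 0 ≤ R1) (hR2 : 0 ≤ R2)
    {M1 M2 : ℕ} {inner : Fin M1 → Fin M2 → Fin k → Fin 3}
    (h1 : ∀ a b a' b', (∀ t, bitOne (inner a b t) = bitOne (inner a' b' t)) → a = a')
    (h2 : ∀ a b a' b', (∀ t, bitTwo (inner a b t) = bitTwo (inner a' b' t)) → b = b')
    {S1 : Finset (Fin L → Fin M1)} {S2 : Finset (Fin L → Fin M2)}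
    (hS1 : ∀ x ∈ S1, ∀ y ∈ S1, x ≠ y → 2 * η * (k * L) < (hammingDist x y : ℝ))
    (hS2 : ∀ x ∈ S2, ∀ y ∈ S2, x ≠ y → 2 * η * (k * L) < (hammingDist x y : ℝ))
    (hc1 : msgCard n R1 ≤ S1.card) (hc2 : msgCard n R2 ≤ S2.card) :
    ∃ enc dec1 dec2, Causal n enc ∧
      errProbFB (blackwellNoisyW p Q) n 0 R1 R2 enc dec1 dec2
        ≤ 3 * Real.exp (-(k * L * (η ^ 2 / 16))) + 2 * Real.exp (-((n - k * L) * (η ^ 2 / 16)))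
          + 2 * Real.exp (n * Real.binEntropy (p + η) - (n - k * L) * Real.log 2) := by
  set T : Finset (Fin n) := Finset.univ.filter fun t => (t : ℕ) < k * L with hTdef
  have hT : ∀ t, t ∈ T ↔ (t : ℕ) < k * L := fun t => by simp [hTdef]
  have hTcard : T.card = k * L := by
    rw [hTdef, Fin.card_filter_val_lt, min_eq_right hn]
  have hTreal : (T.card : ℝ) = k * L := by rw [hTcard]; push_cast; rfl
  have hTc : (Tᶜ.card : ℝ) = n - k * L := by
    rw [Finset.card_compl, Fintype.card_fin, hTcard, Nat.cast_sub hn]; push_cast; rfl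
  obtain ⟨a1, ha1⟩ : ∃ a : Fin (msgCard n R1) → S1, Function.Injective a :=
    ⟨fun i => S1.equivFin.symm (Fin.castLE hc1 i), fun i j h => by simpa using h⟩
  obtain ⟨a2, ha2⟩ : ∃ a : Fin (msgCard n R2) → S2, Function.Injective a :=
    ⟨fun i => S2.equivFin.symm (Fin.castLE hc2 i), fun i j h => by simpa using h⟩
  have hdiv : ∀ t : ℕ, t < k * L → t / k < L := fun t ht => Nat.div_lt_of_lt_mul ht
  set x : Fin (msgCard n R1) → Fin (msgCard n R2) → Fin n → Fin 3 := fun i j t =>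
    if h : (t : ℕ) < k * L then inner ((a1 i).1 ⟨t / k, hdiv t h⟩) ((a2 j).1 ⟨t / k, hdiv t h⟩)
      ⟨t % k, Nat.mod_lt _ hk⟩ else 0 with hx
  have hpos : ∀ (l : Fin L) (r : Fin k), ∃ t : Fin n, (t : ℕ) < k * L ∧ (t : ℕ) / k = l ∧
      ∀ i j, x i j t = inner ((a1 i).1 l) ((a2 j).1 l) r := by
    intro l r
    have hlt : (l : ℕ) * k + r < k * L := by
      have := Nat.mul_le_mul_left k (Nat.succ_le_of_lt l.2)
      have := r.2
      rw [Nat.mul_succ] at *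
      rw [Nat.mul_comm (l : ℕ)]
      omega
    have hd : ((l : ℕ) * k + r) / k = l := by
      rw [Nat.mul_comm, Nat.mul_add_div hk, Nat.div_eq_of_lt r.2, Nat.add_zero]
    have hm : ((l : ℕ) * k + r) % k = r := by
      rw [Nat.mul_comm, Nat.mul_add_mod, Nat.mod_eq_of_lt r.2]
    refine ⟨⟨l * k + r, hlt.trans_le hn⟩, hlt, hd, fun i j => ?_⟩
    simp only [hx, hlt, dif_pos, hd, hm]
  obtain ⟨enc, dec1, dec2, hcaus, herr⟩ := exists_block_code hp0 hQ hη hpη hq n (k * L) hR1 hR2 T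
    hT x (fun i j i' j' hii => by
      rw [hTreal]
      refine (hS1 _ (a1 i).2 _ (a1 i').2 fun h => hii (ha1 (Subtype.ext h))).trans_le ?_
      refine Nat.cast_le.2 (hammingDist_le_card_block (k := k) _ _ _ _ fun l hl => ?_)
      by_contra! hcon
      refine hl (h1 _ ((a2 j).1 l) _ ((a2 j').1 l) fun r => ?_)
      obtain ⟨t, htN, htd, hxt⟩ := hpos l r
      rw [← hxt, ← hxt]
      exact hcon t ((hT t).2 htN) htd) (fun i j i' j' hjj => by
      rw [hTreal]
      refine (hS2 _ (a2 j).2 _ (a2 j').2 fun h => hjj (ha2 (Subtype.ext h))).trans_le ?_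
      refine Nat.cast_le.2 (hammingDist_le_card_block (k := k) _ _ _ _ fun l hl => ?_)
      by_contra! hcon
      refine hl (h2 ((a1 i).1 l) _ ((a1 i').1 l) _ fun r => ?_)
      obtain ⟨t, htN, htd, hxt⟩ := hpos l r
      rw [← hxt, ← hxt]
      exact hcon t ((hT t).2 htN) htd)
  rw [hTreal, hTc] at herr
  exact ⟨enc, dec1, dec2, hcaus, herr⟩

lemma errProbFB_nonneg {X Y1 Y2 Yt : Type*} [Fintype X] [Fintype Y1] [Fintype Y2] [Fintype Yt]
    {W : X → Y1 × Y2 × Yt → ℝ} (hW : ∀ x y, 0 ≤ W x y) (n : ℕ) (R0 R1 R2 : ℝ)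
    (enc : Fin n → Fin (msgCard n R0) × Fin (msgCard n R1) × Fin (msgCard n R2) →
      (Fin n → Yt) → X)
    (dec1 : (Fin n → Y1) → Fin (msgCard n R0) × Fin (msgCard n R1))
    (dec2 : (Fin n → Y2) → Fin (msgCard n R0) × Fin (msgCard n R2)) :
    0 ≤ errProbFB W n R0 R1 R2 enc dec1 dec2 := by
  refine mul_nonneg (by positivity) (Finset.sum_nonneg fun m _ => Finset.sum_nonneg fun y _ =>
    mul_nonneg (Finset.prod_nonneg fun t _ => hW _ _) ?_)
  split_ifs <;> norm_num

lemma tendsto_exp_neg_affine {a : ℝ} (ha : 0 < a) (b : ℝ) :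
    Filter.Tendsto (fun n : ℕ => Real.exp (-(n * a) + b)) Filter.atTop (nhds 0) := by
  refine Real.tendsto_exp_atBot.comp (Filter.tendsto_atBot_add_const_right _ _ ?_)
  exact Filter.tendsto_neg_atTop_atBot.comp
    (Filter.Tendsto.atTop_mul_const ha tendsto_natCast_atTop_atTop)

lemma msgCard_le_of_exp_le {n N : ℕ} {R : ℝ} (h : Real.exp (n * R * Real.log 2) ≤ N) :
    msgCard n R ≤ N := by
  refine (Nat.floor_le_floor ?_).trans (Nat.floor_natCast N).le
  rwa [Real.rpow_def_of_pos two_pos, mul_comm]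

lemma outer_rate_le {γ C k n L : ℝ} (hγ0 : 0 < γ) (hγ1 : γ < 1) (hC : 0 < C) (hk : 0 < k)
    (hn : 4 * k / (C * γ ^ 2) ≤ n) (hL : n * ((1 - γ / 2) * C / k) - 1 ≤ L) :
    n * ((1 - γ) * C / k) ≤ L * (1 - γ / 2) := by
  have e1 : 1 ≤ n * (C / k) * (γ ^ 2 / 4) := by
    rw [div_le_iff₀ (by positivity)] at hn
    have : n * (C / k) * (γ ^ 2 / 4) = n * (C * γ ^ 2) / (4 * k) := by
      field_simp
    rw [this, le_div_iff₀ (by positivity)]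
    linarith
  have e2 := mul_le_mul_of_nonneg_right hL (show 0 ≤ 1 - γ / 2 by linarith)
  have e3 : (n * ((1 - γ / 2) * C / k) - 1) * (1 - γ / 2)
      = n * ((1 - γ) * C / k) + n * (C / k) * (γ ^ 2 / 4) - (1 - γ / 2) := by
    field_simp; ring
  linarith

set_option maxHeartbeats 1000000 in
/-- Concatenating an inner code for the noiseless Blackwell channel with the two-phase feedback
scheme. -/
lemma achievableFB_of_inner_code {p : ℝ} (hp0 : 0 < p) (hp : p < 1 / 2) {k M1 M2 : ℕ} (hk : 1 ≤ k)
    (hM1 : 2 ≤ M1) (hM2 : 2 ≤ M2) {inner : Fin M1 → Fin M2 → Fin k → Fin 3}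
    (h1 : ∀ a b a' b', (∀ t, bitOne (inner a b t) = bitOne (inner a' b' t)) → a = a')
    (h2 : ∀ a b a' b', (∀ t, bitTwo (inner a b t) = bitTwo (inner a' b' t)) → b = b')
    {γ : ℝ} (hγ0 : 0 < γ) (hγ1 : γ < 1) :
    ∃ q > 0, ∀ Q : Bool × Bool → ℝ, IsPMF Q → ∑ w, (if w.1 then Q w else 0) ≤ q →
      AchievableFB (blackwellNoisyW p Q) 0
        ((1 - γ) * (1 - Real.binEntropy p / Real.log 2) * Real.log M1 / (k * Real.log 2))
        ((1 - γ) * (1 - Real.binEntropy p / Real.log 2) * Real.log M2 / (k * Real.log 2)) := by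
  have hl2 : 0 < Real.log 2 := Real.log_pos one_lt_two
  set C : ℝ := 1 - Real.binEntropy p / Real.log 2 with hC
  have hh := binEntropy_lt_log_two_of hp
  have hh0 : 0 < Real.binEntropy p := Real.binEntropy_pos hp0 (by linarith)
  have hC0 : 0 < C := sub_pos.2 ((div_lt_one hl2).2 hh)
  have hC1 : C < 1 := by
    have : 0 < Real.binEntropy p / Real.log 2 := by positivity
    linarith
  have hk0 : (0 : ℝ) < k := by exact_mod_cast hk
  have hlM1 : 0 < Real.log M1 := Real.log_pos (by exact_mod_cast hM1)
  have hlM2 : 0 < Real.log M2 := Real.log_pos (by exact_mod_cast hM2)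
  set c1 : ℝ := 1 - (1 - γ / 2) * C with hc1
  have hc1h : Real.binEntropy p < c1 * Real.log 2 := by
    have e : c1 * Real.log 2
        = Real.binEntropy p + γ / 2 * (Real.log 2 - Real.binEntropy p) := by
      rw [hc1, hC]; field_simp; ring
    have : 0 < γ / 2 * (Real.log 2 - Real.binEntropy p) :=
      mul_pos (by linarith) (by linarith)
    linarith
  have hc1pos : 0 < c1 := by nlinarith
  obtain ⟨δ, hδ, hδ'⟩ := Metric.continuous_iff.1 Real.binEntropy_continuous p
    (c1 * Real.log 2 - Real.binEntropy p) (by linarith)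
  obtain ⟨η₁, hη₁, houter1⟩ := exists_outer_code hM1 k (half_pos hγ0)
  obtain ⟨η₂, hη₂, houter2⟩ := exists_outer_code hM2 k (half_pos hγ0)
  set η : ℝ := min (min η₁ η₂) (min ((1 / 2 - p) / 2) (δ / 2)) with hη
  have hη0 : 0 < η :=
    lt_min (lt_min hη₁ hη₂) (lt_min (by linarith) (by linarith))
  have hηη₁ : η ≤ η₁ := (min_le_left _ _).trans (min_le_left _ _)
  have hηη₂ : η ≤ η₂ := (min_le_left _ _).trans (min_le_right _ _)
  have hηp : η ≤ (1 / 2 - p) / 2 := (min_le_right _ _).trans (min_le_left _ _)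
  have hηδ : η ≤ δ / 2 := (min_le_right _ _).trans (min_le_right _ _)
  have hpη : p + η < 1 / 2 := by linarith
  have hent : Real.binEntropy (p + η) < c1 * Real.log 2 := by
    have := hδ' (p + η) (by
      rw [Real.dist_eq, add_sub_cancel_left, abs_of_pos hη0]; linarith)
    rw [Real.dist_eq] at this
    linarith [(abs_lt.1 this).2]
  refine ⟨η / 2, half_pos hη0, fun Q hQ hq => ?_⟩
  set R1 : ℝ := (1 - γ) * C * Real.log M1 / (k * Real.log 2) with hR1
  set R2 : ℝ := (1 - γ) * C * Real.log M2 / (k * Real.log 2) with hR2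
  have hγ' : 0 < 1 - γ := by linarith
  have hR1nn : 0 ≤ R1 := by positivity
  have hR2nn : 0 ≤ R2 := by positivity
  set c0 : ℝ := (1 - γ / 2) * C / k with hc0
  have hc0pos : 0 < c0 := div_pos (mul_pos (by linarith) hC0) hk0
  have hkc0 : k * c0 = 1 - c1 := by rw [hc0, hc1]; field_simp; ring
  set b : ℕ → ℝ := fun n =>
    3 * Real.exp (-(n * (k * c0 * (η ^ 2 / 16))) + k * (η ^ 2 / 16))
      + 2 * Real.exp (-(n * (c1 * (η ^ 2 / 16))) + 0)
      + 2 * Real.exp (-(n * (c1 * Real.log 2 - Real.binEntropy (p + η))) + 0) with hb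
  have hblim : Filter.Tendsto b Filter.atTop (nhds 0) := by
    have l1 := (tendsto_exp_neg_affine (show 0 < k * c0 * (η ^ 2 / 16) by positivity)
      (k * (η ^ 2 / 16))).const_mul 3
    have l2 := (tendsto_exp_neg_affine (show 0 < c1 * (η ^ 2 / 16) by positivity) 0).const_mul 2
    have l3 := (tendsto_exp_neg_affine (show 0 < c1 * Real.log 2 - Real.binEntropy (p + η) by
      linarith) 0).const_mul 2
    have h := (l1.add l2).add l3
    rw [show (3 * 0 + 2 * 0 + 2 * 0 : ℝ) = 0 by norm_num] at h
    exact h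
  have hex : ∀ n : ℕ, ∃ enc dec1 dec2, Causal n enc ∧ (4 * k / (C * γ ^ 2) ≤ n →
      errProbFB (blackwellNoisyW p Q) n 0 R1 R2 enc dec1 dec2 ≤ b n) := by
    intro n
    by_cases hn : 4 * k / (C * γ ^ 2) ≤ n
    · have hn0 : (0 : ℝ) ≤ n := Nat.cast_nonneg _
      set L : ℕ := ⌊n * c0⌋₊ with hL
      have hLle : (L : ℝ) ≤ n * c0 := Nat.floor_le (by positivity)
      have hLge : n * c0 - 1 ≤ (L : ℝ) := (Nat.sub_one_lt_floor _).le
      have hkLn : (k : ℝ) * L ≤ n * (1 - c1) := by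
        calc (k : ℝ) * L ≤ k * (n * c0) := mul_le_mul_of_nonneg_left hLle hk0.le
          _ = n * (1 - c1) := by rw [← hkc0]; ring
      have hkL : k * L ≤ n := by
        have : (k : ℝ) * L ≤ n := hkLn.trans (mul_le_of_le_one_right hn0 (by linarith))
        exact_mod_cast this
      obtain ⟨S1, hS1, hcard1⟩ := houter1 η hη0 hηη₁ L
      obtain ⟨S2, hS2, hcard2⟩ := houter2 η hη0 hηη₂ L
      have hrate := outer_rate_le hγ0 hγ1 hC0 hk0 hn hLge
      have hsize : ∀ M : ℕ, 0 < Real.log M →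
          n * ((1 - γ) * C * Real.log M / (k * Real.log 2)) * Real.log 2
            ≤ L * ((1 - γ / 2) * Real.log M) := by
        intro M hM
        have e := mul_le_mul_of_nonneg_right hrate hM.le
        have e' : n * ((1 - γ) * C * Real.log M / (k * Real.log 2)) * Real.log 2
            = n * ((1 - γ) * C / k) * Real.log M := by field_simp
        linarith
      have hc1' := msgCard_le_of_exp_le ((Real.exp_le_exp.2 (hsize M1 hlM1)).trans hcard1)
      have hc2' := msgCard_le_of_exp_le ((Real.exp_le_exp.2 (hsize M2 hlM2)).trans hcard2)
      obtain ⟨enc, dec1, dec2, hcaus, herr⟩ := exists_concatenated_code hp0 hQ hη0 hpη hq hk hkL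
        hR1nn hR2nn h1 h2 hS1 hS2 hc1' hc2'
      refine ⟨enc, dec1, dec2, hcaus, fun _ => herr.trans ?_⟩
      have hη16 : 0 < η ^ 2 / 16 := by positivity
      have hkLge : k * (n * c0 - 1) ≤ (k : ℝ) * L := mul_le_mul_of_nonneg_left hLge hk0.le
      have hrest : n * c1 ≤ (n : ℝ) - k * L := by linarith
      have x1 : -(k * L * (η ^ 2 / 16)) ≤ -(n * (k * c0 * (η ^ 2 / 16))) + k * (η ^ 2 / 16) := by
        linarith [mul_le_mul_of_nonneg_right hkLge hη16.le]
      have x2 : -((n - k * L) * (η ^ 2 / 16)) ≤ -(n * (c1 * (η ^ 2 / 16))) + 0 := by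
        linarith [mul_le_mul_of_nonneg_right hrest hη16.le]
      have x3 : n * Real.binEntropy (p + η) - (n - k * L) * Real.log 2
          ≤ -(n * (c1 * Real.log 2 - Real.binEntropy (p + η))) + 0 := by
        linarith [mul_le_mul_of_nonneg_right hrest hl2.le]
      have y1 := Real.exp_le_exp.2 x1
      have y2 := Real.exp_le_exp.2 x2
      have y3 := Real.exp_le_exp.2 x3
      simp only [hb]
      linarith
    · exact ⟨fun _ _ _ => 0, fun _ => (⟨0, msgCard_pos le_rfl⟩, ⟨0, msgCard_pos hR1nn⟩),
        fun _ => (⟨0, msgCard_pos le_rfl⟩, ⟨0, msgCard_pos hR2nn⟩), fun _ _ _ _ _ => rfl,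
        fun h => absurd h hn⟩
  choose enc dec1 dec2 hcaus herr using hex
  refine ⟨le_rfl, hR1nn, hR2nn, enc, dec1, dec2, hcaus, ?_⟩
  refine squeeze_zero' (Filter.Eventually.of_forall fun n => errProbFB_nonneg (fun x y => ?_)
    _ _ _ _ _ _ _) ?_ hblim
  · rw [blackwellNoisyW_eq_noiseLaw]; exact noiseLaw_nonneg hp0 hp hQ _
  · filter_upwards [Filter.eventually_ge_atTop ⌈4 * k / (C * γ ^ 2)⌉₊] with n hn
    exact herr n (Nat.ceil_le.1 hn)

/-- **Corollary (Blackwell with noisy feedback).** For all sufficiently small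
feedback-noise marginals, noisy feedback strictly enlarges the capacity region of
the noisy Blackwell DMBC. -/
theorem blackwell_noisyFB_strict (p : ℝ) (hp0 : 0 < p) (hp : p < 1 / 2) :
    ∃ qbar : ℝ, 0 < qbar ∧
      ∀ Q : Bool × Bool → ℝ, IsPMF Q →
        max (distOf Q (fun v => v.1) true) (distOf Q (fun v => v.2) true) ≤ qbar →
        CNoFB (blackwellW p) ⊂ CGenFB (blackwellNoisyW p Q) := by
  obtain ⟨l, K, hl, h1, h2, hgap⟩ := exists_dual_certificate hp0 hp
  have hl2 : 0 < Real.log 2 := Real.log_pos one_lt_two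
  have hl3 : 0 < Real.log 3 := Real.log_pos (by norm_num)
  set C : ℝ := 1 - Real.binEntropy p / Real.log 2 with hC
  have hC0 : 0 < C := sub_pos.2 ((div_lt_one hl2).2 (binEntropy_lt_log_two_of hp))
  set κ : ℝ := C * Real.log 3 - (K - Real.binEntropy p) with hκ
  have hκ0 : 0 < κ := sub_pos.2 hgap
  obtain ⟨k, M1, M2, inner, hk, hM1, hM2, hi1, hi2, hrate⟩ :=
    exists_inner_code (show 0 < κ / (4 * C) by positivity)
  have hk0 : (0 : ℝ) < k := by exact_mod_cast hk
  set γ : ℝ := min (1 / 2) (κ / (4 * (C * Real.log 3))) with hγ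
  have hγ0 : 0 < γ := lt_min (by norm_num) (by positivity)
  have hγ1 : γ < 1 := (min_le_left _ _).trans_lt (by norm_num)
  have hγκ : γ * (C * Real.log 3) ≤ κ / 4 := by
    have := (le_div_iff₀ (show 0 < 4 * (C * Real.log 3) by positivity)).1
      (min_le_right (1 / 2) (κ / (4 * (C * Real.log 3))))
    linarith
  obtain ⟨q, hq0, hach⟩ := achievableFB_of_inner_code hp0 hp hk hM1 hM2 hi1 hi2 hγ0 hγ1
  refine ⟨q, hq0, fun Q hQ hmax => ⟨CNoFB_subset_CGenFB p hQ, fun hsub => ?_⟩⟩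
  have hA := hach Q hQ (by
    have h := (le_max_left _ _).trans hmax
    simp only [distOf, prOf] at h
    refine (Finset.sum_congr rfl fun w _ => ?_).trans_le h
    split_ifs <;> rfl)
  set R1 : ℝ := (1 - γ) * (1 - Real.binEntropy p / Real.log 2) * Real.log M1 / (k * Real.log 2)
    with hR1
  set R2 : ℝ := (1 - γ) * (1 - Real.binEntropy p / Real.log 2) * Real.log M2 / (k * Real.log 2)
    with hR2
  have hA' : ((0 : ℝ), R1, R2) ∈
      {r : ℝ × ℝ × ℝ | AchievableFB (blackwellNoisyW p Q) r.1 r.2.1 r.2.2} := hA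
  have hmem := CNoFB_sum_rate hp0 hp hl h1 h2 (hsub (subset_closure hA'))
  simp only [zero_add] at hmem
  rw [hR1, hR2, ← hC] at hmem
  have e : ((1 - γ) * C * Real.log M1 / (k * Real.log 2)
      + (1 - γ) * C * Real.log M2 / (k * Real.log 2)) * Real.log 2
        = (1 - γ) * C * ((Real.log M1 + Real.log M2) / k) := by
    field_simp
  rw [e] at hmem
  have hr : Real.log 3 - κ / (4 * C) ≤ (Real.log M1 + Real.log M2) / k := by
    rw [le_div_iff₀ hk0]; linarith
  have hcoef : 0 < (1 - γ) * C := mul_pos (by linarith) hC0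
  have e2 := mul_le_mul_of_nonneg_left hr hcoef.le
  have e3 : (1 - γ) * C * (Real.log 3 - κ / (4 * C))
      = C * Real.log 3 - γ * (C * Real.log 3) - (1 - γ) * (κ / 4) := by
    field_simp
  nlinarith

end BCFB
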